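/- Let g ∈ S₀(ℝ) and let Λ ⊆ ℝ² be a lattice such that (g, Λ) is a Riesz basis for its closed linear span 𝒢 = 𝒢(g, Λ). Then there exists m ∈ ℕ, m ≥ 1, such that 𝔍(𝒢) ⊆ (1/m)Λ. -/

import Mathlib

open MeasureTheory Complex Filter
open scoped ENNReal InnerProductSpace RealInnerProductSpace ComplexConjugate

noncomputable section

/-- The Hilbert space `L²(ℝ)` of complex-valued square-integrable functions. -/
abbrev L2 : Type := Lp ℂ 2 (volume : Measure ℝ)

lemma memLp_translate (a : ℝ) (f : L2) :
    MemLp (fun x : ℝ => f (x - a)) 2 (volume : Measure ℝ) :=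
  (Lp.memLp f).comp_measurePreserving (measurePreserving_sub_right volume a)

lemma memLp_modulate (b : ℝ) (f : L2) :
    MemLp (fun x : ℝ => Complex.exp (2 * Real.pi * Complex.I * (b * x)) * f x) 2
      (volume : Measure ℝ) := by
  refine MemLp.of_le (Lp.memLp f) ?_ ?_
  · exact (Complex.continuous_exp.comp (by fun_prop)).aestronglyMeasurable.mul
      (Lp.aestronglyMeasurable f)
  · filter_upwards with x
    have : Complex.exp (2 * Real.pi * Complex.I * (b * x))
        = Complex.exp ((2 * Real.pi * (b * x) : ℝ) * Complex.I) := by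
      push_cast; ring_nf
    rw [norm_mul, this, Complex.norm_exp_ofReal_mul_I, one_mul]

/-- Translation `T_a` on `L²(ℝ)`: `(T_a f)(x) = f (x - a)`. -/
def Tr (a : ℝ) (f : L2) : L2 := (memLp_translate a f).toLp _

/-- Modulation `M_b` on `L²(ℝ)`: `(M_b f)(x) = e^{2πibx} f x`. -/
def Mo (b : ℝ) (f : L2) : L2 := (memLp_modulate b f).toLp _

/-- Time-frequency shift `π(a,b) = T_a M_b`. -/
def tf (z : ℝ × ℝ) (f : L2) : L2 := Tr z.1 (Mo z.2 f)

/-- The closed linear span `𝒢(g,Λ)` of the Gabor system `(g,Λ)`. -/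
def gaborSpan (g : L2) (Λ : Set (ℝ × ℝ)) : Set L2 :=
  closure (Submodule.span ℂ ((fun z => tf z g) '' Λ) : Set L2)

/-- `𝔍(𝒢)`: the set of time-frequency shifts leaving `𝒢` invariant. -/
def stab (G : Set L2) : Set (ℝ × ℝ) := {z | ∀ f ∈ G, tf z f ∈ G}

/-- `Λ` is a lattice in `ℝ²` if `Λ = Aℤ²` for an invertible `2×2` matrix `A`. -/
def IsLattice (Λ : Set (ℝ × ℝ)) : Prop :=
  ∃ A : Matrix (Fin 2) (Fin 2) ℝ, IsUnit A.det ∧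
    Λ = {p : ℝ × ℝ | ∃ k l : ℤ,
      p = (A 0 0 * k + A 0 1 * l, A 1 0 * k + A 1 1 * l)}

lemma memLp_gaussian : MemLp (fun x : ℝ => (Real.exp (-Real.pi * x ^ 2) : ℂ)) 2
    (volume : Measure ℝ) := by
  rw [memLp_two_iff_integrable_sq_norm]
  · have h : Integrable (fun x : ℝ => Real.exp (-(2 * Real.pi) * x ^ 2)) volume :=
      integrable_exp_neg_mul_sq (by positivity)
    refine h.congr (Eventually.of_forall fun x => ?_)
    simp only [Complex.norm_real, Real.norm_eq_abs, Real.abs_exp, sq, ← Real.exp_add]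
    ring_nf
  · exact (Complex.continuous_ofReal.comp (by fun_prop)).aestronglyMeasurable

/-- The Gaussian `φ(x) = e^{-πx²}` as an element of `L²(ℝ)`. -/
def gaussL2 : L2 := memLp_gaussian.toLp _

/-- The Feichtinger algebra condition: `f ∈ S₀(ℝ)` iff `(a,b) ↦ ⟨f, π(a,b)φ⟩ ∈ L¹(ℝ²)`. -/
def InS0 (f : L2) : Prop :=
  Integrable (fun z : ℝ × ℝ => ⟪tf z gaussL2, f⟫_ℂ) (volume : Measure (ℝ × ℝ))

/-- `(g,Λ)` is a frame for its closed linear span. -/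
def IsFrameSeq (g : L2) (Λ : Set (ℝ × ℝ)) : Prop :=
  ∃ A B : ℝ, 0 < A ∧ 0 < B ∧ ∀ f ∈ gaborSpan g Λ,
    A * ‖f‖ ^ 2 ≤ ∑' lam : Λ, ‖⟪tf (lam : ℝ × ℝ) g, f⟫_ℂ‖ ^ 2 ∧
    ∑' lam : Λ, ‖⟪tf (lam : ℝ × ℝ) g, f⟫_ℂ‖ ^ 2 ≤ B * ‖f‖ ^ 2

/-- `(g,Λ)` is a frame for all of `L²(ℝ)`. -/
def IsFrameL2 (g : L2) (Λ : Set (ℝ × ℝ)) : Prop :=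
  ∃ A B : ℝ, 0 < A ∧ 0 < B ∧ ∀ f : L2,
    A * ‖f‖ ^ 2 ≤ ∑' lam : Λ, ‖⟪tf (lam : ℝ × ℝ) g, f⟫_ℂ‖ ^ 2 ∧
    ∑' lam : Λ, ‖⟪tf (lam : ℝ × ℝ) g, f⟫_ℂ‖ ^ 2 ≤ B * ‖f‖ ^ 2

/-- Euclidean ball of radius `ε` around `a ∈ ℝ²`. -/
def eball (ε : ℝ) (a : ℝ × ℝ) : Set (ℝ × ℝ) :=
  {x : ℝ × ℝ | Real.sqrt ((x.1 - a.1) ^ 2 + (x.2 - a.2) ^ 2) < ε}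

/-- `B_ε(Δ) = ⋃_{a ∈ Δ} B_ε(a)`. -/
def eballSet (ε : ℝ) (Δ : Set (ℝ × ℝ)) : Set (ℝ × ℝ) := ⋃ a ∈ Δ, eball ε a

/-- The separable lattice `αℤ × βℤ`. -/
def sepLattice (α β : ℝ) : Set (ℝ × ℝ) :=
  {p : ℝ × ℝ | ∃ k l : ℤ, p = (α * k, β * l)}


/-- `(g,Λ)` is a Riesz basis for its closed linear span. -/
def IsRieszSeq (g : L2) (Λ : Set (ℝ × ℝ)) : Prop :=
  ∃ A B : ℝ, 0 < A ∧ 0 < B ∧ ∀ c : Λ →₀ ℂ,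
    A * ∑ lam ∈ c.support, ‖c lam‖ ^ 2
        ≤ ‖∑ lam ∈ c.support, c lam • tf (lam : ℝ × ℝ) g‖ ^ 2 ∧
    ‖∑ lam ∈ c.support, c lam • tf (lam : ℝ × ℝ) g‖ ^ 2
        ≤ B * ∑ lam ∈ c.support, ‖c lam‖ ^ 2

section TwistedAlgebra

set_option linter.unusedSectionVars false

variable {ι : Type*} [AddCommGroup ι] {H : Type*} [NormedAddCommGroup H] [InnerProductSpace ℂ H]
  [CompleteSpace H]

/-- The matrix entry of an operator with respect to a Hilbert basis. -/
def entry {ι : Type*} (e : HilbertBasis ι ℂ H) (x : H →L[ℂ] H) (m n : ι) : ℂ := ⟪e m, x (e n)⟫_ℂ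

lemma entry_add {ι : Type*} (e : HilbertBasis ι ℂ H) (x y : H →L[ℂ] H) (m n : ι) :
    entry e (x + y) m n = entry e x m n + entry e y m n := by
  simp [entry]

lemma entry_smul {ι : Type*} (e : HilbertBasis ι ℂ H) (a : ℂ) (x : H →L[ℂ] H) (m n : ι) :
    entry e (a • x) m n = a * entry e x m n := by
  simp [entry]

lemma entry_star {ι : Type*} (e : HilbertBasis ι ℂ H) (x : H →L[ℂ] H) (m n : ι) :
    entry e (star x) m n = conj (entry e x n m) := by
  simp [entry, ContinuousLinearMap.star_eq_adjoint, ContinuousLinearMap.adjoint_inner_right]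

lemma hasSum_entry_mul {ι : Type*} (e : HilbertBasis ι ℂ H) (x y : H →L[ℂ] H) (m n : ι) :
    HasSum (fun k => entry e x m k * entry e y k n) (entry e (x * y) m n) := by
  have h := e.hasSum_inner_mul_inner (ContinuousLinearMap.adjoint x (e m)) (y (e n))
  simpa [entry, ContinuousLinearMap.adjoint_inner_left] using h

lemma entry_algebraMap {ι : Type*} [DecidableEq ι] (e : HilbertBasis ι ℂ H) (a : ℂ) (m n : ι) :
    entry e (algebraMap ℂ (H →L[ℂ] H) a) m n = if m = n then a else 0 := by
  have := orthonormal_iff_ite.mp e.orthonormal m n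
  simp [entry, Algebra.algebraMap_eq_smul_one, this]

lemma continuous_entry {ι : Type*} (e : HilbertBasis ι ℂ H) (m n : ι) :
    Continuous fun x : H →L[ℂ] H => entry e x m n := by
  unfold entry; fun_prop

lemma ext_entry {ι : Type*} (e : HilbertBasis ι ℂ H) {x y : H →L[ℂ] H}
    (h : ∀ m n, entry e x m n = entry e y m n) : x = y := by
  refine ContinuousLinearMap.ext_on (s := Set.range e) ?_ ?_
  · rw [← Submodule.dense_iff_topologicalClosure_eq_top.symm.eq]
    exact e.dense_span
  · rintro _ ⟨n, rfl⟩
    refine e.repr.injective (lp.ext (funext fun m => ?_))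
    rw [e.repr_apply_apply, e.repr_apply_apply]
    exact h m n

/-- The operators whose matrix is invariant under the diagonal action of `ι`, twisted by `c`. -/
def covariantAlgebra (e : HilbertBasis ι ℂ H) (c : ι → ι → Circle) :
    StarSubalgebra ℂ (H →L[ℂ] H) where
  carrier := {x | ∀ l m n, entry e x (l + m) (l + n) = (c l m / c l n : Circle) * entry e x m n}
  mul_mem' {x y} hx hy l m n := by
    have h1 := hasSum_entry_mul e x y (l + m) (l + n)
    rw [← (Equiv.addLeft l).hasSum_iff] at h1
    have h2 := (hasSum_entry_mul e x y m n).mul_left ((c l m / c l n : Circle) : ℂ)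
    refine h1.unique (h2.congr_fun ?_)
    intro k
    have : (c l m / c l n : Circle) = (c l m / c l k) * (c l k / c l n) := by simp
    simp only [Function.comp, Equiv.coe_addLeft, hx l m k, hy l k n, this, Circle.coe_mul]
    ring
  add_mem' {x y} hx hy l m n := by
    rw [entry_add, entry_add, hx, hy, mul_add]
  algebraMap_mem' a l m n := by
    classical
    rw [entry_algebraMap, entry_algebraMap]
    by_cases h : m = n <;> simp [h]
  star_mem' {x} hx l m n := by
    rw [entry_star, entry_star, hx, map_mul, ← Circle.coe_inv_eq_conj, inv_div]

lemma isClosed_covariantAlgebra (e : HilbertBasis ι ℂ H) (c : ι → ι → Circle) :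
    IsClosed (covariantAlgebra e c : Set (H →L[ℂ] H)) := by
  have : (covariantAlgebra e c : Set (H →L[ℂ] H)) = ⋂ (l) (m) (n),
      {x | entry e x (l + m) (l + n) = (c l m / c l n : Circle) * entry e x m n} := by
    ext x; simp [covariantAlgebra]
  rw [this]
  exact isClosed_iInter fun l => isClosed_iInter fun m => isClosed_iInter fun n =>
    isClosed_eq (continuous_entry e _ _) (continuous_const.mul (continuous_entry e _ _))

/-- The vacuum state is tracial on the covariant algebra. -/
lemma entry_zero_mul_comm {e : HilbertBasis ι ℂ H} {c : ι → ι → Circle} {x y : H →L[ℂ] H}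
    (hx : x ∈ covariantAlgebra e c) (hy : y ∈ covariantAlgebra e c) :
    entry e (x * y) 0 0 = entry e (y * x) 0 0 := by
  have h1 := hasSum_entry_mul e x y 0 0
  have h2 := hasSum_entry_mul e y x 0 0
  rw [← (Equiv.neg ι).hasSum_iff] at h2
  refine h1.unique (h2.congr_fun fun k => ?_)
  have hx' := hx (-k) 0 k
  have hy' := hy (-k) k 0
  simp only [add_zero, neg_add_cancel] at hx' hy'
  have : (((c (-k) k / c (-k) 0 : Circle) : ℂ)) * ((c (-k) 0 / c (-k) k : Circle) : ℂ) = 1 := by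
    rw [← Circle.coe_mul]; simp
  simp only [Function.comp, Equiv.neg_apply, hx', hy']
  linear_combination (-entry e x 0 k * entry e y k 0) * this

lemma ext_of_covariant {e : HilbertBasis ι ℂ H} {c : ι → ι → Circle} {x y : H →L[ℂ] H}
    (hx : x ∈ covariantAlgebra e c) (hy : y ∈ covariantAlgebra e c) (h : x (e 0) = y (e 0)) :
    x = y := by
  refine ext_entry e fun m n => ?_
  have hx' := hx n (m - n) 0
  have hy' := hy n (m - n) 0
  simp only [add_zero, add_sub_cancel] at hx' hy'
  rw [hx', hy', entry, entry, h]

/-- `x'` is the commutator of `x` with the diagonal operator with entries `ℓ`. -/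
def IsDeriv (e : HilbertBasis ι ℂ H) (ℓ : ι →+ ℝ) (x x' : H →L[ℂ] H) : Prop :=
  ∀ m n, entry e x' m n = (ℓ m - ℓ n) * entry e x m n

lemma IsDeriv.add {e : HilbertBasis ι ℂ H} {ℓ : ι →+ ℝ} {x x' y y' : H →L[ℂ] H}
    (hx : IsDeriv e ℓ x x') (hy : IsDeriv e ℓ y y') : IsDeriv e ℓ (x + y) (x' + y') := by
  intro m n; rw [entry_add, entry_add, hx, hy, mul_add]

lemma IsDeriv.smul {e : HilbertBasis ι ℂ H} {ℓ : ι →+ ℝ} {x x' : H →L[ℂ] H}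
    (hx : IsDeriv e ℓ x x') (a : ℂ) : IsDeriv e ℓ (a • x) (a • x') := by
  intro m n; rw [entry_smul, entry_smul, hx]; ring

lemma IsDeriv.mul {e : HilbertBasis ι ℂ H} {ℓ : ι →+ ℝ} {x x' y y' : H →L[ℂ] H}
    (hx : IsDeriv e ℓ x x') (hy : IsDeriv e ℓ y y') :
    IsDeriv e ℓ (x * y) (x' * y + x * y') := by
  intro m n
  rw [entry_add]
  have h1 := (hasSum_entry_mul e x' y m n).add (hasSum_entry_mul e x y' m n)
  have h2 := (hasSum_entry_mul e x y m n).mul_left ((ℓ m - ℓ n : ℂ))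
  refine h1.unique (h2.congr_fun fun k => ?_)
  rw [hx, hy]; ring

lemma isDeriv_algebraMap (e : HilbertBasis ι ℂ H) (ℓ : ι →+ ℝ) (a : ℂ) :
    IsDeriv e ℓ (algebraMap ℂ (H →L[ℂ] H) a) 0 := by
  classical
  intro m n
  rw [entry_algebraMap]
  by_cases h : m = n <;> simp [h, entry]

lemma IsDeriv.star {e : HilbertBasis ι ℂ H} {ℓ : ι →+ ℝ} {x x' : H →L[ℂ] H}
    (hx : IsDeriv e ℓ x x') : IsDeriv e ℓ (star x) ((-1 : ℂ) • star x') := by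
  intro m n
  rw [entry_smul, entry_star, entry_star, hx, map_mul, map_sub, conj_ofReal, conj_ofReal]
  ring

lemma IsDeriv.mem_covariantAlgebra {e : HilbertBasis ι ℂ H} {c : ι → ι → Circle} {ℓ : ι →+ ℝ}
    {x x' : H →L[ℂ] H} (h : IsDeriv e ℓ x x') (hx : x ∈ covariantAlgebra e c) :
    x' ∈ covariantAlgebra e c := by
  intro l m n
  rw [h, h, hx]
  simp only [map_add]
  push_cast
  ring

/-- The covariant operators that are differentiable in the direction `ℓ`. -/
def smoothAlgebra (e : HilbertBasis ι ℂ H) (c : ι → ι → Circle) (ℓ : ι →+ ℝ) :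
    StarSubalgebra ℂ (H →L[ℂ] H) where
  carrier := {x | x ∈ covariantAlgebra e c ∧ ∃ x', IsDeriv e ℓ x x'}
  mul_mem' := fun ⟨hx, _, hx'⟩ ⟨hy, _, hy'⟩ => ⟨mul_mem hx hy, _, hx'.mul hy'⟩
  add_mem' := fun ⟨hx, _, hx'⟩ ⟨hy, _, hy'⟩ => ⟨add_mem hx hy, _, hx'.add hy'⟩
  algebraMap_mem' a := ⟨algebraMap_mem _ a, _, isDeriv_algebraMap e ℓ a⟩
  star_mem' := fun ⟨hx, _, hx'⟩ => ⟨star_mem hx, _, hx'.star⟩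

/-- The norm closure of the smooth algebra (a noncommutative torus). -/
def torusAlgebra (e : HilbertBasis ι ℂ H) (c : ι → ι → Circle) (ℓ : ι →+ ℝ) :
    StarSubalgebra ℂ (H →L[ℂ] H) :=
  (smoothAlgebra e c ℓ).topologicalClosure

lemma smoothAlgebra_le (e : HilbertBasis ι ℂ H) (c : ι → ι → Circle) (ℓ : ι →+ ℝ) :
    smoothAlgebra e c ℓ ≤ torusAlgebra e c ℓ :=
  StarSubalgebra.le_topologicalClosure _

lemma isClosed_torusAlgebra (e : HilbertBasis ι ℂ H) (c : ι → ι → Circle) (ℓ : ι →+ ℝ) :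
    IsClosed (torusAlgebra e c ℓ : Set (H →L[ℂ] H)) :=
  StarSubalgebra.isClosed_topologicalClosure _

/-- A closed star subalgebra of operators is closed under inverses. -/
lemma mem_of_mul_eq_one (S : StarSubalgebra ℂ (H →L[ℂ] H))
    (hS : IsClosed (S : Set (H →L[ℂ] H))) {x y : H →L[ℂ] H} (hx : x ∈ S) (hxy : x * y = 1)
    (hyx : y * x = 1) : y ∈ S := by
  have : IsClosed (S : Set (H →L[ℂ] H)) := hS
  have hu : IsUnit ((⟨x, hx⟩ : S) : H →L[ℂ] H) := ⟨⟨x, y, hxy, hyx⟩, rfl⟩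
  obtain ⟨v, hv⟩ := (StarSubalgebra.coe_isUnit S).mp hu
  have h1 : ((v⁻¹ : Sˣ) : S) * (v : S) = 1 := Units.inv_mul v
  have h2 : (((v⁻¹ : Sˣ) : S) : H →L[ℂ] H) * x = 1 := by
    have := congrArg (fun s : S => (s : H →L[ℂ] H)) h1
    simpa [hv] using this
  have : y = ((v⁻¹ : Sˣ) : S) := by
    calc y = ((((v⁻¹ : Sˣ) : S) : H →L[ℂ] H) * x) * y := by rw [h2, one_mul]
      _ = _ := by rw [mul_assoc, hxy, mul_one]
  rw [this]
  exact Subtype.property _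

/-- The smooth invertible elements with vanishing winding number. -/
def zeroWinding (e : HilbertBasis ι ℂ H) (c : ι → ι → Circle) (ℓ : ι →+ ℝ) :
    Submonoid (H →L[ℂ] H) where
  carrier := {y | y ∈ covariantAlgebra e c ∧ ∃ y' z, IsDeriv e ℓ y y' ∧ y * z = 1 ∧ z * y = 1 ∧
    entry e (z * y') 0 0 = 0}
  one_mem' := by
    refine ⟨one_mem _, 0, 1, ?_, by simp, by simp, by simp [entry]⟩
    simpa using isDeriv_algebraMap e ℓ 1
  mul_mem' {y₁ y₂} h₁ h₂ := by
    obtain ⟨hy₁, y₁', z₁, hd₁, hr₁, hl₁, ht₁⟩ := h₁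
    obtain ⟨hy₂, y₂', z₂, hd₂, hr₂, hl₂, ht₂⟩ := h₂
    have hz (y z : H →L[ℂ] H) (h : y ∈ covariantAlgebra e c) (hr : y * z = 1) (hl : z * y = 1) :
        z ∈ covariantAlgebra e c :=
      mem_of_mul_eq_one _ (isClosed_covariantAlgebra e c) h hr hl
    refine ⟨mul_mem hy₁ hy₂, _, z₂ * z₁, hd₁.mul hd₂, ?_, ?_, ?_⟩
    · rw [mul_assoc, ← mul_assoc y₂, hr₂, one_mul, hr₁]
    · rw [mul_assoc, ← mul_assoc z₁, hl₁, one_mul, hl₂]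
    · have e1 : z₂ * z₁ * (y₁' * y₂ + y₁ * y₂') = z₂ * (z₁ * y₁' * y₂) + z₂ * y₂' := by
        rw [mul_add, mul_assoc z₂ z₁ (y₁ * y₂'), ← mul_assoc z₁ y₁, hl₁, one_mul]
        simp only [mul_assoc]
      have hm : z₁ * y₁' * y₂ ∈ covariantAlgebra e c :=
        mul_mem (mul_mem (hz _ _ hy₁ hr₁ hl₁) (hd₁.mem_covariantAlgebra hy₁)) hy₂
      rw [e1, entry_add, ht₂, add_zero, entry_zero_mul_comm (hz _ _ hy₂ hr₂ hl₂) hm, mul_assoc,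
        hr₂, mul_one, ht₁]

lemma IsDeriv.pow_succ {e : HilbertBasis ι ℂ H} {c : ι → ι → Circle} {ℓ : ι →+ ℝ}
    {x x' : H →L[ℂ] H} (h : IsDeriv e ℓ x x') (hx : x ∈ covariantAlgebra e c) (n : ℕ) :
    ∃ d, IsDeriv e ℓ (x ^ (n + 1)) d ∧
      ∀ k : ℕ, entry e (x ^ k * d) 0 0 = (n + 1) * entry e (x ^ (n + k) * x') 0 0 := by
  induction n with
  | zero => exact ⟨x', by simpa using h, by simp⟩
  | succ n ih =>
    obtain ⟨d, hd, ht⟩ := ih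
    refine ⟨_, _root_.pow_succ x (n + 1) ▸ hd.mul h, fun k => ?_⟩
    have hd' := hd.mem_covariantAlgebra (pow_mem hx (n + 1))
    rw [mul_add, entry_add, ← mul_assoc, entry_zero_mul_comm (mul_mem (pow_mem hx k) hd') hx,
      ← mul_assoc, ← pow_succ', ht, ← mul_assoc, ← pow_add]
    push_cast
    rw [show n + (k + 1) = n + 1 + k by ring, show k + (n + 1) = n + 1 + k by ring]
    ring

lemma IsDeriv.entry_zero_pow_mul {e : HilbertBasis ι ℂ H} {c : ι → ι → Circle} {ℓ : ι →+ ℝ}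
    {x x' : H →L[ℂ] H} (h : IsDeriv e ℓ x x') (hx : x ∈ covariantAlgebra e c) (n : ℕ) :
    entry e (x ^ n * x') 0 0 = 0 := by
  obtain ⟨d, hd, ht⟩ := h.pow_succ hx n
  have h1 := ht 0
  rw [pow_zero, one_mul, add_zero, hd, sub_self, zero_mul] at h1
  have : (n + 1 : ℂ) ≠ 0 := by exact_mod_cast n.succ_ne_zero
  exact (mul_eq_zero.mp h1.symm).resolve_left this

/-- Smooth elements close to the identity have vanishing winding number. -/
lemma entry_zero_inv_mul_deriv {e : HilbertBasis ι ℂ H} {c : ι → ι → Circle} {ℓ : ι →+ ℝ}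
    {y y' z : H →L[ℂ] H} (hy : y ∈ covariantAlgebra e c) (hd : IsDeriv e ℓ y y')
    (h1 : ‖1 - y‖ < 1) (hz : z * y = 1) : entry e (z * y') 0 0 = 0 := by
  set r := 1 - y with hr
  have hyr : y = 1 - r := by simp [hr]
  have hzr : z = ∑' n : ℕ, r ^ n := by
    calc z = z * ((1 - r) * ∑' n : ℕ, r ^ n) := by rw [mul_neg_geom_series r h1, mul_one]
      _ = _ := by rw [← mul_assoc, ← hyr, hz, one_mul]
  have hrc : r ∈ covariantAlgebra e c := sub_mem (one_mem _) hy
  have hrd : IsDeriv e ℓ r ((-1 : ℂ) • y') := by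
    have := (isDeriv_algebraMap e ℓ 1).add (hd.smul (-1))
    simpa [hr, sub_eq_add_neg] using this
  have hs : HasSum (fun n : ℕ => r ^ n) z :=
    hzr ▸ (summable_geometric_of_norm_lt_one h1).hasSum
  have h2 : HasSum (fun n : ℕ => entry e (r ^ n * y') 0 0) (entry e (z * y') 0 0) := by
    have := (hs.mul_right y').mapL ((innerSL ℂ (e 0)).comp
      (ContinuousLinearMap.apply ℂ H (e 0)))
    simpa [entry] using this
  refine h2.unique (hasSum_zero.congr_fun fun n => ?_)
  have h3 := hrd.entry_zero_pow_mul hrc n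
  rw [mul_smul_comm, entry_smul] at h3
  simpa using h3

lemma exists_inverse_of_norm_lt {y : H →L[ℂ] H} (h : ‖1 - y‖ < 1) :
    ∃ z, y * z = 1 ∧ z * y = 1 := by
  refine ⟨∑' n : ℕ, (1 - y) ^ n, ?_, ?_⟩
  · simpa using mul_neg_geom_series (1 - y) h
  · simpa using geom_series_mul_neg (1 - y) h

lemma mem_closure_zeroWinding_of_norm_lt {e : HilbertBasis ι ℂ H} {c : ι → ι → Circle}
    {ℓ : ι →+ ℝ} {u : H →L[ℂ] H} (hu : u ∈ torusAlgebra e c ℓ) (h : ‖1 - u‖ < 1) :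
    u ∈ (zeroWinding e c ℓ).topologicalClosure := by
  have hu' : u ∈ closure (smoothAlgebra e c ℓ : Set (H →L[ℂ] H)) := hu
  have hopen : IsOpen {y : H →L[ℂ] H | ‖1 - y‖ < 1} :=
    isOpen_lt (by fun_prop) continuous_const
  have := hopen.inter_closure ⟨h, hu'⟩
  refine closure_mono ?_ this
  rintro y ⟨hy1, hy, y', hd⟩
  obtain ⟨z, hr, hl⟩ := exists_inverse_of_norm_lt hy1
  exact ⟨hy, y', z, hd, hr, hl, entry_zero_inv_mul_deriv hy hd hy1 hl⟩

/-- An eigenvector of the derivation with nonzero eigenvalue has nonzero winding number. -/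
lemma notMem_closure_zeroWinding {e : HilbertBasis ι ℂ H} {c : ι → ι → Circle} {ℓ : ι →+ ℝ}
    {U V : H →L[ℂ] H} {a : ℂ} (ha : a ≠ 0) (hV : V ∈ covariantAlgebra e c)
    (hUV : U * V = 1) (hVU : V * U = 1) (hdV : IsDeriv e ℓ V (a • V)) :
    U ∉ (zeroWinding e c ℓ).topologicalClosure := by
  intro hU
  have hU' : U ∈ closure (zeroWinding e c ℓ : Set (H →L[ℂ] H)) := hU
  have hopen : IsOpen {y : H →L[ℂ] H | ‖1 - V * y‖ < 1} :=
    isOpen_lt (by fun_prop) continuous_const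
  have hmem : U ∈ {y : H →L[ℂ] H | ‖1 - V * y‖ < 1} := by simp [hVU]
  obtain ⟨y, hy1, hy, y', z, hd, hr, hl, ht⟩ := mem_closure_iff.mp hU' _ hopen hmem
  have key := entry_zero_inv_mul_deriv (mul_mem hV hy) (hdV.mul hd) hy1 (z := z * U)
    (by rw [mul_assoc, ← mul_assoc U, hUV, one_mul, hl])
  have e1 : z * U * (a • V * y + V * y') = a • 1 + z * y' := by
    rw [mul_add, smul_mul_assoc, mul_smul_comm, mul_assoc, mul_assoc, ← mul_assoc U, ← mul_assoc U,
      hUV, one_mul, one_mul, hl]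
  have e2 : entry e (1 : H →L[ℂ] H) 0 0 = 1 := by
    classical
    simpa using entry_algebraMap e 1 0 0
  rw [e1, entry_add, ht, entry_smul, e2] at key
  simp [ha] at key

lemma smul_mem_closure_zeroWinding {e : HilbertBasis ι ℂ H} {c : ι → ι → Circle} {ℓ : ι →+ ℝ}
    {u : H →L[ℂ] H} (hu : u ∈ (zeroWinding e c ℓ).topologicalClosure) (w : Circle) :
    (w : ℂ) • u ∈ (zeroWinding e c ℓ).topologicalClosure := by
  have : algebraMap ℂ (H →L[ℂ] H) w ∈ zeroWinding e c ℓ := by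
    refine ⟨algebraMap_mem _ _, 0, algebraMap ℂ (H →L[ℂ] H) (w⁻¹ : Circle),
      isDeriv_algebraMap e ℓ _, ?_, ?_, by simp [entry]⟩ <;>
    · rw [← map_mul, ← Circle.coe_mul]; simp
  simpa [Algebra.algebraMap_eq_smul_one] using
    mul_mem ((zeroWinding e c ℓ).le_topologicalClosure this) hu

end TwistedAlgebra

section Synthesis

variable {ι : Type*} [AddCommGroup ι] {H : Type*} [NormedAddCommGroup H] [InnerProductSpace ℂ H]
  [CompleteSpace H] {E : Type*} [NormedAddCommGroup E] [InnerProductSpace ℂ E]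
  [CompleteSpace E]

set_option linter.unusedSectionVars false

/-- Schur's test for a Gram matrix dominated by a summable convolution kernel. -/
lemma norm_sum_smul_sq_le {v : ι → E} {a : ι → ℝ} (ha : Summable a) (ha0 : ∀ m, 0 ≤ a m)
    (h : ∀ m n, ‖⟪v m, v n⟫_ℂ‖ ≤ a (n - m)) (s : Finset ι) (b : ι → ℂ) :
    ‖∑ m ∈ s, b m • v m‖ ^ 2 ≤ (∑' m, a m) * ∑ m ∈ s, ‖b m‖ ^ 2 := by
  have hrow (m : ι) : ∑ n ∈ s, a (n - m) ≤ ∑' m, a m := by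
    have := ((Equiv.subRight m).summable_iff (f := a)).mpr ha
    refine (this.sum_le_tsum s fun n _ => ha0 _).trans_eq ?_
    exact (Equiv.subRight m).tsum_eq a
  have hcol (n : ι) : ∑ m ∈ s, a (n - m) ≤ ∑' m, a m := by
    have := ((Equiv.subLeft n).summable_iff (f := a)).mpr ha
    refine (this.sum_le_tsum s fun m _ => ha0 _).trans_eq ?_
    exact (Equiv.subLeft n).tsum_eq a
  calc ‖∑ m ∈ s, b m • v m‖ ^ 2
      = ‖⟪∑ m ∈ s, b m • v m, ∑ n ∈ s, b n • v n⟫_ℂ‖ := by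
        rw [inner_self_eq_norm_sq_to_K]; simp
    _ = ‖∑ m ∈ s, ∑ n ∈ s, conj (b m) * (b n * ⟪v m, v n⟫_ℂ)‖ := by
        rw [sum_inner]
        simp_rw [inner_sum, inner_smul_left, inner_smul_right]
    _ ≤ ∑ m ∈ s, ∑ n ∈ s, ‖conj (b m) * (b n * ⟪v m, v n⟫_ℂ)‖ :=
        (norm_sum_le _ _).trans (Finset.sum_le_sum fun m _ => norm_sum_le _ _)
    _ ≤ ∑ m ∈ s, ∑ n ∈ s, (‖b m‖ ^ 2 / 2 * a (n - m) + ‖b n‖ ^ 2 / 2 * a (n - m)) := by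
        refine Finset.sum_le_sum fun m _ => Finset.sum_le_sum fun n _ => ?_
        rw [norm_mul, norm_mul, RCLike.norm_conj]
        have h1 : ‖b m‖ * (‖b n‖ * ‖⟪v m, v n⟫_ℂ‖) ≤ ‖b m‖ * (‖b n‖ * a (n - m)) := by
          gcongr; exact h m n
        nlinarith [mul_nonneg (sq_nonneg (‖b m‖ - ‖b n‖)) (ha0 (n - m))]
    _ = ∑ m ∈ s, ‖b m‖ ^ 2 / 2 * ∑ n ∈ s, a (n - m)
        + ∑ n ∈ s, ‖b n‖ ^ 2 / 2 * ∑ m ∈ s, a (n - m) := by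
        simp only [Finset.sum_add_distrib, Finset.mul_sum]
        congr 1
        exact Finset.sum_comm
    _ ≤ ∑ m ∈ s, ‖b m‖ ^ 2 / 2 * ∑' m, a m + ∑ n ∈ s, ‖b n‖ ^ 2 / 2 * ∑' m, a m := by
        gcongr with m _ n _
        · exact hrow m
        · exact hcol n
    _ = (∑' m, a m) * ∑ m ∈ s, ‖b m‖ ^ 2 := by
        rw [← Finset.sum_mul, ← Finset.sum_div]; ring

lemma sum_norm_inner_sq_le {v : ι → E} {a : ι → ℝ} (ha : Summable a) (ha0 : ∀ m, 0 ≤ a m)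
    (h : ∀ m n, ‖⟪v m, v n⟫_ℂ‖ ≤ a (n - m)) (s : Finset ι) (f : E) :
    ∑ m ∈ s, ‖⟪v m, f⟫_ℂ‖ ^ 2 ≤ (∑' m, a m) * ‖f‖ ^ 2 := by
  set S := ∑ m ∈ s, ‖⟪v m, f⟫_ℂ‖ ^ 2 with hS
  have hS0 : 0 ≤ S := Finset.sum_nonneg fun _ _ => by positivity
  have hC0 : 0 ≤ ∑' m, a m := tsum_nonneg ha0
  have h1 := norm_sum_smul_sq_le ha ha0 h s fun m => ⟪v m, f⟫_ℂ
  have h2 : ⟪∑ m ∈ s, ⟪v m, f⟫_ℂ • v m, f⟫_ℂ = (S : ℂ) := by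
    simp only [sum_inner, inner_smul_left, hS]
    push_cast
    refine Finset.sum_congr rfl fun m _ => ?_
    rw [mul_comm, Complex.mul_conj']
  have h3 : S ≤ ‖∑ m ∈ s, ⟪v m, f⟫_ℂ • v m‖ * ‖f‖ := by
    have := norm_inner_le_norm (𝕜 := ℂ) (∑ m ∈ s, ⟪v m, f⟫_ℂ • v m) f
    rw [h2, Complex.norm_real, Real.norm_of_nonneg hS0] at this
    exact this
  have h4 : S ^ 2 ≤ ((∑' m, a m) * S) * ‖f‖ ^ 2 := by
    calc S ^ 2 ≤ (‖∑ m ∈ s, ⟪v m, f⟫_ℂ • v m‖ * ‖f‖) ^ 2 := by gcongr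
      _ = ‖∑ m ∈ s, ⟪v m, f⟫_ℂ • v m‖ ^ 2 * ‖f‖ ^ 2 := by ring
      _ ≤ _ := by gcongr
  rcases hS0.eq_or_lt with h0 | h0
  · rw [← h0]; positivity
  · refine le_of_mul_le_mul_left ?_ h0
    nlinarith

lemma exists_synthesis (e : HilbertBasis ι ℂ H) {v : ι → E} {a : ι → ℝ} (ha : Summable a)
    (ha0 : ∀ m, 0 ≤ a m) (h : ∀ m n, ‖⟪v m, v n⟫_ℂ‖ ≤ a (n - m)) :
    ∃ T : H →L[ℂ] E, (∀ m, T (e m) = v m) ∧ ‖T‖ ^ 2 ≤ ∑' m, a m := by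
  classical
  have hC0 : 0 ≤ ∑' m, a m := tsum_nonneg ha0
  have hmem (f : E) : Memℓp (fun m => ⟪v m, f⟫_ℂ) 2 := by
    refine memℓp_gen' (C := (∑' m, a m) * ‖f‖ ^ 2) fun s => ?_
    simpa using sum_norm_inner_sq_le ha ha0 h s f
  let S₀ : E →ₗ[ℂ] lp (fun _ : ι => ℂ) 2 :=
    { toFun := fun f => ⟨fun m => ⟪v m, f⟫_ℂ, hmem f⟩
      map_add' := fun f g => by ext m; exact inner_add_right _ _ _
      map_smul' := fun r f => by ext m; exact inner_smul_right _ _ _ }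
  have hbound (f : E) : ‖S₀ f‖ ≤ √(∑' m, a m) * ‖f‖ := by
    refine lp.norm_le_of_forall_sum_le (by norm_num) (by positivity) fun s => ?_
    have := sum_norm_inner_sq_le ha ha0 h s f
    simp only [ENNReal.toReal_ofNat, Real.rpow_ofNat, mul_pow, Real.sq_sqrt hC0]
    exact this
  let S : E →L[ℂ] lp (fun _ : ι => ℂ) 2 := S₀.mkContinuous _ hbound
  refine ⟨(ContinuousLinearMap.adjoint S).comp
    (e.repr.toContinuousLinearEquiv : H →L[ℂ] lp (fun _ : ι => ℂ) 2), fun m => ?_, ?_⟩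
  · refine ext_inner_right ℂ fun f => ?_
    simp only [ContinuousLinearMap.comp_apply, ContinuousLinearMap.adjoint_inner_left]
    have : (e.repr.toContinuousLinearEquiv : H →L[ℂ] lp (fun _ : ι => ℂ) 2) (e m)
        = lp.single 2 m (1 : ℂ) := e.repr_self m
    rw [this, lp.inner_single_left]
    simp [S, S₀]
  · have h1 : ‖S‖ ≤ √(∑' m, a m) := S₀.mkContinuous_norm_le (by positivity) hbound
    have h2 : ‖(ContinuousLinearMap.adjoint S).comp
        (e.repr.toContinuousLinearEquiv : H →L[ℂ] lp (fun _ : ι => ℂ) 2)‖ ≤ √(∑' m, a m) := by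
      refine ContinuousLinearMap.opNorm_le_bound _ (by positivity) fun x => ?_
      have := (ContinuousLinearMap.adjoint S).le_opNorm (e.repr x)
      rw [LinearIsometryEquiv.norm_map, LinearIsometryEquiv.norm_map] at this
      exact this.trans (by gcongr)
    calc _ ≤ (√(∑' m, a m)) ^ 2 := by gcongr
      _ = _ := Real.sq_sqrt hC0

lemma ext_basis {ι : Type*} (e : HilbertBasis ι ℂ H) {x y : H →L[ℂ] E}
    (h : ∀ n, x (e n) = y (e n)) : x = y := by
  refine ContinuousLinearMap.ext_on (s := Set.range e) ?_ ?_
  · rw [← Submodule.dense_iff_topologicalClosure_eq_top.symm.eq]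
    exact e.dense_span
  · rintro _ ⟨n, rfl⟩
    exact h n

lemma norm_synthesis_sq_le (e : HilbertBasis ι ℂ H) {v : ι → E} {a : ι → ℝ} (ha : Summable a)
    (ha0 : ∀ m, 0 ≤ a m) (h : ∀ m n, ‖⟪v m, v n⟫_ℂ‖ ≤ a (n - m)) {T : H →L[ℂ] E}
    (hT : ∀ m, T (e m) = v m) : ‖T‖ ^ 2 ≤ ∑' m, a m := by
  obtain ⟨T', hT', hn⟩ := exists_synthesis e ha ha0 h
  rwa [show T = T' from ext_basis e fun n => by rw [hT, hT']]

lemma exists_shiftOp (e : HilbertBasis ι ℂ H) (w : ι → Circle) (s : ι) :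
    ∃ W : H →L[ℂ] H, (∀ m, W (e m) = (w m : ℂ) • e (m + s)) ∧ ‖W‖ ^ 2 ≤ 1 := by
  classical
  obtain ⟨W, h1, h2⟩ := exists_synthesis e (v := fun m => (w m : ℂ) • e (m + s))
    (a := Pi.single 0 1) (hasSum_pi_single 0 1).summable
    (fun m => by by_cases h : m = 0 <;> simp [h]) (fun m n => by
      rw [inner_smul_left, inner_smul_right, orthonormal_iff_ite.mp e.orthonormal]
      by_cases h : m = n
      · simp [h, Circle.norm_coe]
      · simp [h, sub_eq_zero, Ne.symm h])
  exact ⟨W, h1, by rwa [(hasSum_pi_single (0 : ι) (1 : ℝ)).tsum_eq] at h2⟩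

/-- The weighted shift `e m ↦ w m • e (m + s)`. -/
def shiftOp (e : HilbertBasis ι ℂ H) (w : ι → Circle) (s : ι) : H →L[ℂ] H :=
  (exists_shiftOp e w s).choose

lemma shiftOp_apply (e : HilbertBasis ι ℂ H) (w : ι → Circle) (s m : ι) :
    shiftOp e w s (e m) = (w m : ℂ) • e (m + s) :=
  (exists_shiftOp e w s).choose_spec.1 m

lemma norm_shiftOp_le (e : HilbertBasis ι ℂ H) (w : ι → Circle) (s : ι) :
    ‖shiftOp e w s‖ ≤ 1 := by
  have := (exists_shiftOp e w s).choose_spec.2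
  exact (sq_le_one_iff₀ (norm_nonneg _)).mp this

lemma shiftOp_mul (e : HilbertBasis ι ℂ H) (w w' : ι → Circle) (s s' : ι) :
    shiftOp e w s * shiftOp e w' s' = shiftOp e (fun m => w' m * w (m + s')) (s' + s) := by
  refine ext_basis e fun m => ?_
  simp [shiftOp_apply, smul_smul, add_assoc]

lemma shiftOp_one (e : HilbertBasis ι ℂ H) : shiftOp e (fun _ => 1) 0 = 1 :=
  ext_basis e fun m => by simp [shiftOp_apply]

lemma entry_shiftOp [DecidableEq ι] (e : HilbertBasis ι ℂ H) (w : ι → Circle) (s m n : ι) :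
    entry e (shiftOp e w s) m n = if m = n + s then (w n : ℂ) else 0 := by
  simp [entry, shiftOp_apply, orthonormal_iff_ite.mp e.orthonormal]

lemma isDeriv_shiftOp (e : HilbertBasis ι ℂ H) (ℓ : ι →+ ℝ) (w : ι → Circle) (s : ι) :
    IsDeriv e ℓ (shiftOp e w s) ((ℓ s : ℂ) • shiftOp e w s) := by
  classical
  intro m n
  rw [entry_smul, entry_shiftOp]
  by_cases h : m = n + s <;> simp [h]

variable {c : ι → ι → Circle}

lemma shiftOp_mem_covariantAlgebra (e : HilbertBasis ι ℂ H)
    (hl : ∀ l l' m, c (l + l') m = c l m * c l' m) (hr : ∀ l m m', c l (m + m') = c l m * c l m')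
    (s : ι) : shiftOp e (fun m => c m s) s ∈ covariantAlgebra e c := by
  classical
  intro l m n
  rw [entry_shiftOp, entry_shiftOp]
  by_cases h : m = n + s
  · subst h
    simp [add_assoc, hl, hr]
  · simp [h, add_assoc]

lemma shiftOp_mem_smoothAlgebra (e : HilbertBasis ι ℂ H) (ℓ : ι →+ ℝ)
    (hl : ∀ l l' m, c (l + l') m = c l m * c l' m) (hr : ∀ l m m', c l (m + m') = c l m * c l m')
    (s : ι) : shiftOp e (fun m => c m s) s ∈ smoothAlgebra e c ℓ :=
  ⟨shiftOp_mem_covariantAlgebra e hl hr s, _, isDeriv_shiftOp e ℓ _ s⟩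

/-- Twisted translations in a direction seen by `ℓ` have nonzero winding number. -/
lemma shiftOp_notMem_closure_zeroWinding (e : HilbertBasis ι ℂ H) (ℓ : ι →+ ℝ)
    (hl : ∀ l l' m, c (l + l') m = c l m * c l' m) (hr : ∀ l m m', c l (m + m') = c l m * c l m')
    {s : ι} (hs : ℓ s ≠ 0) :
    shiftOp e (fun m => c m s) s ∉ (zeroWinding e c ℓ).topologicalClosure := by
  have h1 : shiftOp e (fun m => c m s) s * shiftOp e (fun m => (c (m - s) s)⁻¹) (-s) = 1 := by
    rw [shiftOp_mul, ← shiftOp_one e]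
    simp [sub_eq_add_neg]
  have h2 : shiftOp e (fun m => (c (m - s) s)⁻¹) (-s) * shiftOp e (fun m => c m s) s = 1 := by
    rw [shiftOp_mul, ← shiftOp_one e]
    simp
  refine notMem_closure_zeroWinding (a := (ℓ (-s) : ℂ)) (by simpa using hs) ?_ h1 h2
    (isDeriv_shiftOp e ℓ _ _)
  exact mem_of_mul_eq_one _ (isClosed_covariantAlgebra e c)
    (shiftOp_mem_covariantAlgebra e hl hr s) h1 h2

lemma torusAlgebra_le_covariantAlgebra (e : HilbertBasis ι ℂ H) (c : ι → ι → Circle)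
    (ℓ : ι →+ ℝ) : torusAlgebra e c ℓ ≤ covariantAlgebra e c :=
  StarSubalgebra.topologicalClosure_minimal (fun _ hx => hx.1) (isClosed_covariantAlgebra e c)

/-- Covariant operators with absolutely summable matrix columns belong to the torus algebra. -/
lemma mem_torusAlgebra_of_summable (e : HilbertBasis ι ℂ H) (ℓ : ι →+ ℝ)
    (hl : ∀ l l' m, c (l + l') m = c l m * c l' m) (hr : ∀ l m m', c l (m + m') = c l m * c l m')
    {x : H →L[ℂ] H} (hx : x ∈ covariantAlgebra e c) (hs : Summable fun m => ‖entry e x m 0‖) :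
    x ∈ torusAlgebra e c ℓ := by
  have hsum : Summable fun m => entry e x m 0 • shiftOp e (fun n => c n m) m := by
    refine Summable.of_norm_bounded hs fun m => ?_
    rw [norm_smul]
    exact mul_le_of_le_one_right (norm_nonneg _) (norm_shiftOp_le e _ _)
  have hy : ∑' m, entry e x m 0 • shiftOp e (fun n => c n m) m ∈ torusAlgebra e c ℓ := by
    refine (isClosed_torusAlgebra e c ℓ).mem_of_tendsto hsum.hasSum (Eventually.of_forall ?_)
    intro s
    exact sum_mem fun m _ => SMulMemClass.smul_mem _
      (smoothAlgebra_le e c ℓ (shiftOp_mem_smoothAlgebra e ℓ hl hr m))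
  have hc0 (m : ι) : c 0 m = 1 := by simpa using hl 0 0 m
  convert hy
  refine ext_of_covariant hx (torusAlgebra_le_covariantAlgebra e c ℓ hy) ?_
  have h1 := hsum.hasSum.mapL (ContinuousLinearMap.apply ℂ H (e 0))
  have h2 := e.hasSum_repr (x (e 0))
  refine h2.unique (h1.congr_fun fun m => ?_)
  simp [shiftOp_apply, hc0, e.repr_apply_apply, entry]

/-- Conjugation by a diagonal unitary whose entries form a character preserves the torus
algebra. -/
lemma conj_shiftOp_mem_torusAlgebra (e : HilbertBasis ι ℂ H) (ℓ : ι →+ ℝ) {d : ι → Circle}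
    (hd : ∀ m n, d (m + n) = d m * d n) {x : H →L[ℂ] H} (hx : x ∈ torusAlgebra e c ℓ) :
    star (shiftOp e d 0) * x * shiftOp e d 0 ∈ torusAlgebra e c ℓ := by
  have hent (x : H →L[ℂ] H) (m n : ι) : entry e (star (shiftOp e d 0) * x * shiftOp e d 0) m n
      = (d n / d m : Circle) * entry e x m n := by
    have : (d n / d m : Circle) = (d n : ℂ) * conj (d m : ℂ) := by
      rw [← Circle.coe_inv_eq_conj, div_eq_mul_inv, Circle.coe_mul]
    rw [this]
    simp only [entry, mul_apply_eq_comp, ContinuousLinearMap.star_eq_adjoint,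
      ContinuousLinearMap.adjoint_inner_right, shiftOp_apply, add_zero, map_smul,
      inner_smul_left, inner_smul_right]
    ring
  have hcont : Continuous fun x : H →L[ℂ] H => star (shiftOp e d 0) * x * shiftOp e d 0 := by
    fun_prop
  refine map_mem_closure (f := fun x => star (shiftOp e d 0) * x * shiftOp e d 0) hcont hx ?_
  rintro y ⟨hy, y', hy'⟩
  refine ⟨fun l m n => ?_, star (shiftOp e d 0) * y' * shiftOp e d 0, fun m n => ?_⟩
  · rw [hent, hent, hy, hd, hd, mul_div_mul_left_eq_div]
    ring
  · rw [hent, hent, hy']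
    ring

lemma star_shiftOp_mul_self (e : HilbertBasis ι ℂ H) (d : ι → Circle) :
    star (shiftOp e d 0) * shiftOp e d 0 = 1 := by
  classical
  refine ext_entry e fun m n => ?_
  have : entry e (1 : H →L[ℂ] H) m n = if m = n then 1 else 0 := by
    simpa using entry_algebraMap e 1 m n
  rw [this]
  simp only [entry, mul_apply_eq_comp, ContinuousLinearMap.star_eq_adjoint,
      ContinuousLinearMap.adjoint_inner_right, shiftOp_apply, add_zero,
      inner_smul_left, inner_smul_right, orthonormal_iff_ite.mp e.orthonormal]
  by_cases h : m = n
  · subst h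
    simp [← Circle.coe_inv_eq_conj]
  · simp [h]

lemma shiftOp_mul_star_self (e : HilbertBasis ι ℂ H) (d : ι → Circle) :
    shiftOp e d 0 * star (shiftOp e d 0) = 1 := by
  have h1 : shiftOp e d 0 * shiftOp e (fun m => (d m)⁻¹) 0 = 1 := by
    rw [shiftOp_mul, ← shiftOp_one e]; simp
  have h2 : star (shiftOp e d 0) = shiftOp e (fun m => (d m)⁻¹) 0 := by
    calc _ = star (shiftOp e d 0) * (shiftOp e d 0 * shiftOp e (fun m => (d m)⁻¹) 0) := by
          rw [h1, mul_one]
      _ = _ := by rw [← mul_assoc, star_shiftOp_mul_self, one_mul]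
  rw [h2, h1]

end Synthesis

section TimeFrequency

open scoped FourierTransform

lemma ae_comp_sub_right {P : ℝ → Prop} (h : ∀ᵐ x, P x) (a : ℝ) : ∀ᵐ x, P (x - a) :=
  (measurePreserving_sub_right volume a).quasiMeasurePreserving.ae h

lemma coeFn_tf (z : ℝ × ℝ) (f : L2) :
    ∀ᵐ x, tf z f x = (𝐞 (z.2 * (x - z.1)) : ℂ) * f (x - z.1) := by
  have h1 : ∀ᵐ x, tf z f x = Mo z.2 f (x - z.1) := (memLp_translate z.1 (Mo z.2 f)).coeFn_toLp
  filter_upwards [h1, ae_comp_sub_right (memLp_modulate z.2 f).coeFn_toLp z.1] with x hx hx'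
  rw [hx, Mo, hx', Real.fourierChar_apply]
  push_cast
  ring_nf

lemma tf_add (z : ℝ × ℝ) (f g : L2) : tf z (f + g) = tf z f + tf z g := by
  refine Lp.ext ?_
  filter_upwards [coeFn_tf z (f + g), coeFn_tf z f, coeFn_tf z g, Lp.coeFn_add (tf z f) (tf z g),
    ae_comp_sub_right (Lp.coeFn_add f g) z.1] with x h1 h2 h3 h4 h5
  rw [h1, h4, h5, Pi.add_apply, Pi.add_apply, h2, h3, mul_add]

lemma tf_smul (z : ℝ × ℝ) (r : ℂ) (f : L2) : tf z (r • f) = r • tf z f := by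
  refine Lp.ext ?_
  filter_upwards [coeFn_tf z (r • f), coeFn_tf z f, Lp.coeFn_smul r (tf z f),
    ae_comp_sub_right (Lp.coeFn_smul r f) z.1] with x h1 h2 h4 h5
  rw [h1, h4, h5, Pi.smul_apply, Pi.smul_apply, h2, smul_eq_mul, smul_eq_mul]
  ring

lemma norm_tf (z : ℝ × ℝ) (f : L2) : ‖tf z f‖ = ‖f‖ := by
  rw [Lp.norm_def, Lp.norm_def]
  congr 1
  calc eLpNorm (tf z f) 2 volume = eLpNorm (fun x => f (x - z.1)) 2 volume := by
        refine eLpNorm_congr_norm_ae ?_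
        filter_upwards [coeFn_tf z f] with x hx
        rw [hx, norm_mul, Circle.norm_coe, one_mul]
    _ = eLpNorm f 2 volume :=
        eLpNorm_comp_measurePreserving (Lp.aestronglyMeasurable f)
          (measurePreserving_sub_right volume z.1)

/-- The time-frequency shift `π(z)` as a linear isometry of `L²(ℝ)`. -/
def tfL (z : ℝ × ℝ) : L2 →ₗᵢ[ℂ] L2 where
  toFun := tf z
  map_add' := tf_add z
  map_smul' := tf_smul z
  norm_map' := norm_tf z

lemma tfL_apply (z : ℝ × ℝ) (f : L2) : tfL z f = tf z f := rfl

lemma tf_tf (z w : ℝ × ℝ) (f : L2) :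
    tf z (tf w f) = (𝐞 (z.2 * w.1) : ℂ) • tf (z + w) f := by
  refine Lp.ext ?_
  filter_upwards [coeFn_tf z (tf w f), coeFn_tf (z + w) f, ae_comp_sub_right (coeFn_tf w f) z.1,
    Lp.coeFn_smul (𝐞 (z.2 * w.1) : ℂ) (tf (z + w) f)] with x h1 h2 h3 h4
  rw [h1, h3, h4, Pi.smul_apply, h2, smul_eq_mul, ← mul_assoc, ← mul_assoc, ← Circle.coe_mul,
    ← Circle.coe_mul, ← AddChar.map_add_eq_mul, ← AddChar.map_add_eq_mul]
  simp only [Prod.fst_add, Prod.snd_add]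
  rw [show x - z.1 - w.1 = x - (z.1 + w.1) by ring]
  congr 3
  ring_nf

lemma tf_zero (f : L2) : tf 0 f = f := by
  refine Lp.ext ?_
  filter_upwards [coeFn_tf 0 f] with x h1
  simp [h1]

lemma tf_add_eq (z w : ℝ × ℝ) (f : L2) :
    tf (z + w) f = (𝐞 (-(z.2 * w.1)) : ℂ) • tf z (tf w f) := by
  rw [tf_tf, smul_smul, ← Circle.coe_mul, ← AddChar.map_add_eq_mul]
  simp

lemma inner_tf_tf (z : ℝ × ℝ) (f g : L2) : ⟪tf z f, tf z g⟫_ℂ = ⟪f, g⟫_ℂ :=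
  (tfL z).inner_map_map f g

lemma norm_inner_tf_tf (z w : ℝ × ℝ) (f g : L2) :
    ‖⟪tf z f, tf w g⟫_ℂ‖ = ‖⟪tf (z - w) f, g⟫_ℂ‖ := by
  have : tf z f = (𝐞 (-(w.2 * (z - w).1)) : ℂ) • tf w (tf (z - w) f) := by
    rw [← tf_add_eq, add_sub_cancel]
  rw [this, inner_smul_left, inner_tf_tf, norm_mul, RCLike.norm_conj, Circle.norm_coe, one_mul]

/-- The ambiguity function of the Gaussian. -/
lemma inner_tf_gaussL2 (z : ℝ × ℝ) : ⟪tf z gaussL2, gaussL2⟫_ℂ =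
    (Real.pi / (2 * Real.pi) : ℂ) ^ (1 / 2 : ℂ) *
      cexp (-(Real.pi / 2) * (z.1 ^ 2 + z.2 ^ 2) + Real.pi * z.1 * z.2 * I) := by
  have hint := integral_cexp_quadratic (b := -(2 * Real.pi)) (by simp [Real.pi_pos])
    (2 * Real.pi * (z.1 - z.2 * I)) (2 * Real.pi * z.1 * z.2 * I - Real.pi * z.1 ^ 2)
  rw [neg_neg] at hint
  have hpi : (Real.pi : ℂ) ≠ 0 := by exact_mod_cast Real.pi_ne_zero
  rw [L2.inner_def]
  calc ∫ x, ⟪tf z gaussL2 x, gaussL2 x⟫_ℂ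
      = ∫ x : ℝ, cexp (-(2 * Real.pi) * x ^ 2 + 2 * Real.pi * (z.1 - z.2 * I) * x
          + (2 * Real.pi * z.1 * z.2 * I - Real.pi * z.1 ^ 2)) := by
        refine integral_congr_ae ?_
        filter_upwards [coeFn_tf z gaussL2, memLp_gaussian.coeFn_toLp,
          ae_comp_sub_right memLp_gaussian.coeFn_toLp z.1] with x h1 h2 h3
        rw [h1, gaussL2, h2, h3, RCLike.inner_apply, map_mul, Real.fourierChar_apply,
          ← Complex.exp_conj, Complex.conj_ofReal, Complex.ofReal_exp, Complex.ofReal_exp,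
          ← Complex.exp_add, ← Complex.exp_add]
        congr 1
        simp only [map_mul, Complex.conj_ofReal, Complex.conj_I]
        push_cast
        ring
    _ = _ := hint
    _ = _ := by
        congr 2
        field_simp
        ring_nf
        simp only [Complex.I_sq]
        ring

lemma norm_inner_tf_gaussL2_le (z : ℝ × ℝ) : ‖⟪tf z gaussL2, gaussL2⟫_ℂ‖ ≤
    Real.exp (-(Real.pi / 2) * (z.1 ^ 2 + z.2 ^ 2)) := by
  rw [inner_tf_gaussL2, norm_mul, Complex.norm_exp]
  have h1 : ‖(Real.pi / (2 * Real.pi) : ℂ) ^ (1 / 2 : ℂ)‖ ≤ 1 := by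
    rw [show (Real.pi / (2 * Real.pi) : ℂ) = ((1 / 2 : ℝ) : ℂ) by
        have hpi : (Real.pi : ℂ) ≠ 0 := by exact_mod_cast Real.pi_ne_zero
        push_cast; field_simp,
      Complex.norm_cpow_eq_rpow_re_of_pos (by norm_num)]
    exact Real.rpow_le_one (by norm_num) (by norm_num) (by norm_num)
  have h2 : (-(Real.pi / 2 : ℂ) * (z.1 ^ 2 + z.2 ^ 2) + Real.pi * z.1 * z.2 * I).re
      = -(Real.pi / 2) * (z.1 ^ 2 + z.2 ^ 2) := by
    have : (-(Real.pi / 2 : ℂ) * (z.1 ^ 2 + z.2 ^ 2) + Real.pi * z.1 * z.2 * I)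
      = ((-(Real.pi / 2) * (z.1 ^ 2 + z.2 ^ 2) : ℝ) : ℂ) + ((Real.pi * z.1 * z.2 : ℝ) : ℂ) * I := by
      push_cast; ring
    rw [this, Complex.add_re, Complex.ofReal_re, Complex.re_ofReal_mul, Complex.I_re, mul_zero,
      add_zero]
  rw [h2]
  exact mul_le_of_le_one_left (Real.exp_nonneg _) h1

lemma continuous_inner_tf_gaussL2 : Continuous fun z : ℝ × ℝ => ⟪tf z gaussL2, gaussL2⟫_ℂ := by
  simp_rw [inner_tf_gaussL2]
  fun_prop

lemma tendsto_norm_tf_sub_gaussL2 :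
    Tendsto (fun z : ℝ × ℝ => ‖tf z gaussL2 - gaussL2‖ ^ 2) (nhds 0) (nhds 0) := by
  have h (z : ℝ × ℝ) : ‖tf z gaussL2 - gaussL2‖ ^ 2
      = 2 * ‖gaussL2‖ ^ 2 - 2 * (⟪tf z gaussL2, gaussL2⟫_ℂ).re := by
    rw [@norm_sub_sq ℂ, norm_tf]
    simp only [RCLike.re_to_complex]
    ring
  have hc : Continuous fun z : ℝ × ℝ => 2 * ‖gaussL2‖ ^ 2 - 2 * (⟪tf z gaussL2, gaussL2⟫_ℂ).re :=
    continuous_const.sub (continuous_const.mul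
      (Complex.continuous_re.comp continuous_inner_tf_gaussL2))
  simp_rw [h]
  have := hc.tendsto 0
  rwa [← h, tf_zero, sub_self, norm_zero, zero_pow two_ne_zero] at this

end TimeFrequency

section Inversion

open scoped FourierTransform SchwartzMap

lemma continuous_tf_gaussL2 : Continuous fun z : ℝ × ℝ => tf z gaussL2 := by
  rw [continuous_iff_continuousAt]
  intro w
  have hn (z : ℝ × ℝ) : ‖tf z gaussL2 - tf w gaussL2‖ ^ 2 = 2 * ‖gaussL2‖ ^ 2
      - 2 * (conj (𝐞 (-(w.2 * (z - w).1)) : ℂ) * ⟪tf (z - w) gaussL2, gaussL2⟫_ℂ).re := by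
    have : tf z gaussL2 = (𝐞 (-(w.2 * (z - w).1)) : ℂ) • tf w (tf (z - w) gaussL2) := by
      rw [← tf_add_eq, add_sub_cancel]
    rw [@norm_sub_sq ℂ, norm_tf, norm_tf, this, inner_smul_left, inner_tf_tf]
    simp only [RCLike.re_to_complex]
    ring
  have hc : Continuous fun z : ℝ × ℝ => 2 * ‖gaussL2‖ ^ 2
      - 2 * (conj (𝐞 (-(w.2 * (z - w).1)) : ℂ) * ⟪tf (z - w) gaussL2, gaussL2⟫_ℂ).re := by
    have h1 : Continuous fun z : ℝ × ℝ => (𝐞 (-(w.2 * (z - w).1)) : ℂ) :=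
      continuous_subtype_val.comp (Real.continuous_fourierChar.comp (by fun_prop))
    have h2 := continuous_inner_tf_gaussL2.comp (continuous_sub_right w)
    exact continuous_const.sub (continuous_const.mul
      (Complex.continuous_re.comp ((Complex.continuous_conj.comp h1).mul h2)))
  have h0 := hc.tendsto w
  simp_rw [← hn] at h0
  rw [ContinuousAt, tendsto_iff_norm_sub_tendsto_zero]
  have := h0.sqrt
  simpa [Real.sqrt_sq (norm_nonneg _)] using this

/-- The Gaussian window. -/
def gaussFun (x : ℝ) : ℂ := (Real.exp (-Real.pi * x ^ 2) : ℂ)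

lemma contDiff_gaussFun : ContDiff ℝ (⊤ : ℕ∞) gaussFun := by
  unfold gaussFun
  exact Complex.ofRealCLM.contDiff.comp
    (Real.contDiff_exp.comp (f := fun x : ℝ => -Real.pi * x ^ 2) (by fun_prop))

lemma conj_gaussFun (x : ℝ) : conj (gaussFun x) = gaussFun x := Complex.conj_ofReal _

lemma gaussFun_neg (x : ℝ) : gaussFun (-x) = gaussFun x := by simp [gaussFun]

lemma inner_tf_gaussL2_eq_fourier (z : ℝ × ℝ) (f : L2) : ⟪tf z gaussL2, f⟫_ℂ =
    (𝐞 (z.2 * z.1) : ℂ) * 𝓕 (fun x => gaussFun (x - z.1) * f x) z.2 := by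
  rw [L2.inner_def, Real.fourier_real_eq, ← integral_const_mul]
  refine integral_congr_ae ?_
  filter_upwards [coeFn_tf z gaussL2, ae_comp_sub_right memLp_gaussian.coeFn_toLp z.1] with x h1 h3
  have h3' : gaussL2 (x - z.1) = gaussFun (x - z.1) := h3
  rw [h1, h3', RCLike.inner_apply, map_mul, conj_gaussFun, ← Circle.coe_inv_eq_conj,
    ← AddChar.map_neg_eq_inv, Circle.smul_def, smul_eq_mul,
    show -(z.2 * (x - z.1)) = z.2 * z.1 + -(x * z.2) by ring, AddChar.map_add_eq_mul,
    Circle.coe_mul]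
  ring

lemma integral_inner_fourier_schwartz {f : ℝ → ℂ} (hf : Integrable f) (h : 𝓢(ℝ, ℂ)) :
    ∫ ξ, ⟪𝓕 f ξ, 𝓕 (h : ℝ → ℂ) ξ⟫_ℂ = ∫ x, ⟪f x, h x⟫_ℂ := by
  have key := VectorFourier.integral_sesq_fourierIntegral_eq_neg_flip (innerSL ℂ (E := ℂ))
    (L := innerₗ ℝ) Real.continuous_fourierChar continuous_inner hf
    ((𝓕 h).integrable (μ := volume))
  have h2 : ∀ x, VectorFourier.fourierIntegral 𝐞 volume (-(innerₗ ℝ).flip)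
      ((𝓕 h : 𝓢(ℝ, ℂ)) : ℝ → ℂ) x = h x := by
    intro x
    have : 𝓕⁻ (𝓕 h) x = h x := by rw [FourierTransform.fourierInv_fourier_eq]
    rw [← this, SchwartzMap.fourierInv_coe]
    simp only [flip_innerₗ]
    rfl
  simp_rw [h2] at key
  exact key

lemma memLp_gaussFun_sub (a : ℝ) : MemLp (fun x => gaussFun (x - a)) 2 :=
  memLp_gaussian.comp_measurePreserving (measurePreserving_sub_right volume a)

lemma integrable_gaussFun_sq : Integrable fun x => gaussFun x * gaussFun x :=
  memLp_gaussian.integrable_mul memLp_gaussian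

lemma integral_gaussFun_sq : ∫ x, gaussFun x * gaussFun x = ((‖gaussL2‖ ^ 2 : ℝ) : ℂ) := by
  have h := inner_self_eq_norm_sq_to_K (𝕜 := ℂ) gaussL2
  rw [L2.inner_def] at h
  rw [Complex.ofReal_pow]
  refine Eq.trans (integral_congr_ae ?_) h
  filter_upwards [memLp_gaussian.coeFn_toLp] with x hx
  have hx' : gaussL2 x = gaussFun x := hx
  rw [RCLike.inner_apply, hx', conj_gaussFun]

/-- The orthogonality relation for the short-time Fourier transform against a test function. -/
lemma integral_inner_mul_inner_of_contDiff {g : L2} (hg : InS0 g) (h : L2) {k : ℝ → ℂ}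
    (hk : h =ᵐ[volume] k) (hk1 : HasCompactSupport k) (hk2 : ContDiff ℝ (⊤ : ℕ∞) k) :
    ∫ z, conj ⟪tf z gaussL2, g⟫_ℂ * ⟪tf z gaussL2, h⟫_ℂ
      = ((‖gaussL2‖ ^ 2 : ℝ) : ℂ) * ⟪g, h⟫_ℂ := by
  have hint : Integrable (fun z : ℝ × ℝ => conj ⟪tf z gaussL2, g⟫_ℂ * ⟪tf z gaussL2, h⟫_ℂ) := by
    have h1 : Integrable (fun z : ℝ × ℝ => conj ⟪tf z gaussL2, g⟫_ℂ) :=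
      (LinearIsometryEquiv.integrable_comp_iff Complex.conjLIE).mpr hg
    refine h1.mul_bdd (c := ‖gaussL2‖ * ‖h‖)
      (continuous_tf_gaussL2.inner continuous_const).aestronglyMeasurable ?_
    refine Eventually.of_forall fun z => (norm_inner_le_norm _ _).trans_eq ?_
    rw [norm_tf]
  have hgh : Integrable fun x => ⟪g x, h x⟫_ℂ := L2.integrable_inner g h
  have hslice (a : ℝ) : ∫ b, conj ⟪tf (a, b) gaussL2, g⟫_ℂ * ⟪tf (a, b) gaussL2, h⟫_ℂ
      = ∫ x, ⟪g x, h x⟫_ℂ * (gaussFun (a - x) * gaussFun (a - x)) := by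
    have hsm : ContDiff ℝ (⊤ : ℕ∞) fun x => gaussFun (x - a) * k x :=
      (contDiff_gaussFun.comp (contDiff_id.sub contDiff_const)).mul hk2
    have hsupp : HasCompactSupport fun x => gaussFun (x - a) * k x := hk1.mul_left
    have h1 := integral_inner_fourier_schwartz
      ((memLp_gaussFun_sub a).integrable_mul (Lp.memLp g)) (hsupp.toSchwartzMap hsm)
    have h2 : 𝓕 (fun x => gaussFun (x - a) * h x) = 𝓕 (fun x => gaussFun (x - a) * k x) := by
      funext b
      refine Real.fourier_congr_ae ?_ b
      filter_upwards [hk] with x hx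
      rw [hx]
    calc _ = ∫ b, ⟪𝓕 (fun x => gaussFun (x - a) * g x) b,
            𝓕 (fun x => gaussFun (x - a) * k x) b⟫_ℂ := by
          refine integral_congr_ae (Eventually.of_forall fun b => ?_)
          simp only [inner_tf_gaussL2_eq_fourier, h2, map_mul, RCLike.inner_apply]
          have : conj (𝐞 (b * a) : ℂ) * (𝐞 (b * a) : ℂ) = 1 := by
            rw [← Circle.coe_inv_eq_conj, ← Circle.coe_mul, inv_mul_cancel, Circle.coe_one]
          linear_combination (conj (𝓕 (fun x => gaussFun (x - a) * g x) b) *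
            𝓕 (fun x => gaussFun (x - a) * k x) b) * this
      _ = _ := h1
      _ = _ := by
          refine integral_congr_ae ?_
          filter_upwards [hk] with x hx
          have : gaussFun (a - x) = gaussFun (x - a) := by rw [← gaussFun_neg, neg_sub]
          simp only [HasCompactSupport.toSchwartzMap_toFun, RCLike.inner_apply, map_mul,
            conj_gaussFun, hx, this, Pi.mul_apply]
          ring
  rw [Measure.volume_eq_prod, integral_prod _ hint]
  simp_rw [hslice]
  have hprod := Integrable.convolution_integrand (ContinuousLinearMap.mul ℂ ℂ) hgh
    integrable_gaussFun_sq
  rw [integral_integral_swap hprod]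
  have hx (x : ℝ) : ∫ a, ⟪g x, h x⟫_ℂ * (gaussFun (a - x) * gaussFun (a - x))
      = ((‖gaussL2‖ ^ 2 : ℝ) : ℂ) * ⟪g x, h x⟫_ℂ := by
    rw [integral_const_mul, integral_sub_right_eq_self (fun a => gaussFun a * gaussFun a) x,
      integral_gaussFun_sq, mul_comm]
  simp_rw [hx]
  rw [integral_const_mul, L2.inner_def]

lemma integrable_smul_tf_gaussL2 {g : L2} (hg : InS0 g) :
    Integrable fun z : ℝ × ℝ => ⟪tf z gaussL2, g⟫_ℂ • tf z gaussL2 :=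
  hg.smul_bdd ‖gaussL2‖ continuous_tf_gaussL2.aestronglyMeasurable
    (Eventually.of_forall fun z => (norm_tf z gaussL2).le)

/-- The inversion formula for the short-time Fourier transform on the Feichtinger algebra. -/
lemma integral_smul_tf_gaussL2 {g : L2} (hg : InS0 g) :
    ∫ z, ⟪tf z gaussL2, g⟫_ℂ • tf z gaussL2 = ((‖gaussL2‖ ^ 2 : ℝ) : ℂ) • g := by
  have hd := Lp.dense_hasCompactSupport_contDiff (F := ℂ) (μ := (volume : Measure ℝ)) (p := 2)
    (by norm_num)
  refine hd.eq_of_inner_left ℂ ?_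
  rintro h ⟨k, hk, hk1, hk2⟩
  rw [inner_smul_left, Complex.conj_ofReal,
    ← integral_inner_mul_inner_of_contDiff hg h hk hk1 hk2, ← inner_conj_symm,
    ← integral_inner (integrable_smul_tf_gaussL2 hg), ← integral_conj]
  refine integral_congr_ae (Eventually.of_forall fun z => ?_)
  simp only [inner_smul_right, map_mul, inner_conj_symm]

lemma gaussL2_ne_zero : gaussL2 ≠ 0 := by
  intro h
  have h0 := inner_tf_gaussL2 0
  rw [h, inner_zero_right] at h0
  have hpi : (Real.pi : ℂ) ≠ 0 := by exact_mod_cast Real.pi_ne_zero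
  have h1 : (Real.pi / (2 * Real.pi) : ℂ) ≠ 0 := by simp [hpi]
  exact mul_ne_zero (fun h => h1 ((Complex.cpow_eq_zero_iff _ _).mp h).1) (Complex.exp_ne_zero _)
    h0.symm

end Inversion

section GaborSynthesis

open scoped FourierTransform

set_option linter.unusedSectionVars false

variable {ι : Type*} [AddCommGroup ι] {H : Type*} [NormedAddCommGroup H] [InnerProductSpace ℂ H]
  [CompleteSpace H] {e : HilbertBasis ι ℂ H} {p : ι →+ ℝ × ℝ}

/-- The bicharacter with `π(p l) π(p m) = cocycle p l m • π(p (l + m))`. -/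
def cocycle (p : ι →+ ℝ × ℝ) (l m : ι) : Circle := 𝐞 ((p l).2 * (p m).1)

lemma cocycle_add_left (p : ι →+ ℝ × ℝ) (l l' m : ι) :
    cocycle p (l + l') m = cocycle p l m * cocycle p l' m := by
  simp [cocycle, ← AddChar.map_add_eq_mul, add_mul]

lemma cocycle_add_right (p : ι →+ ℝ × ℝ) (l m m' : ι) :
    cocycle p l (m + m') = cocycle p l m * cocycle p l m' := by
  simp [cocycle, ← AddChar.map_add_eq_mul, mul_add]

/-- The commutation character with `π(p m) π(z) = commChar p z m • π(z) π(p m)`. -/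
def commChar (p : ι →+ ℝ × ℝ) (z : ℝ × ℝ) (m : ι) : Circle :=
  𝐞 ((p m).2 * z.1 - z.2 * (p m).1)

lemma commChar_add (p : ι →+ ℝ × ℝ) (z : ℝ × ℝ) (m n : ι) :
    commChar p z (m + n) = commChar p z m * commChar p z n := by
  rw [commChar, commChar, commChar, ← AddChar.map_add_eq_mul]
  congr 1
  simp
  ring

lemma commChar_smul_tf_tf (p : ι →+ ℝ × ℝ) (z : ℝ × ℝ) (m : ι) (f : L2) :
    (commChar p z m : ℂ) • tf z (tf (p m) f) = tf (p m) (tf z f) := by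
  rw [tf_tf, tf_tf, smul_smul, ← Circle.coe_mul, commChar, ← AddChar.map_add_eq_mul, add_comm z]
  simp

/-- `T` is the synthesis operator of the Gabor system generated by `f`. -/
def IsSynth (e : HilbertBasis ι ℂ H) (p : ι →+ ℝ × ℝ) (f : L2) (T : H →L[ℂ] L2) : Prop :=
  ∀ m, T (e m) = tf (p m) f

/-- The operation `T ↦ π(z) T D_z` on synthesis operators. -/
def twist (e : HilbertBasis ι ℂ H) (p : ι →+ ℝ × ℝ) (z : ℝ × ℝ) :
    (H →L[ℂ] L2) →L[ℂ] (H →L[ℂ] L2) :=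
  (ContinuousLinearMap.compL ℂ H L2 L2 (tfL z).toContinuousLinearMap).comp
    ((ContinuousLinearMap.compL ℂ H H L2).flip (shiftOp e (commChar p z) 0))

lemma twist_apply (z : ℝ × ℝ) (T : H →L[ℂ] L2) (x : H) :
    twist e p z T x = tf z (T (shiftOp e (commChar p z) 0 x)) := rfl

lemma IsSynth.twist {f : L2} {T : H →L[ℂ] L2} (hT : IsSynth e p f T) (z : ℝ × ℝ) :
    IsSynth e p (tf z f) (twist e p z T) := fun m => by
  rw [twist_apply, shiftOp_apply, add_zero, map_smul, tf_smul, hT, commChar_smul_tf_tf]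

lemma IsSynth.smul {f : L2} {T : H →L[ℂ] L2} (hT : IsSynth e p f T) (r : ℂ) :
    IsSynth e p (r • f) (r • T) := fun m => by
  rw [smul_apply, hT, tf_smul]

lemma IsSynth.sub {f f' : L2} {T T' : H →L[ℂ] L2} (hT : IsSynth e p f T)
    (hT' : IsSynth e p f' T') : IsSynth e p (f - f') (T - T') := fun m => by
  rw [sub_apply, hT, hT']
  exact ((tfL (p m)).map_sub f f').symm

lemma IsSynth.unique {f : L2} {T T' : H →L[ℂ] L2} (hT : IsSynth e p f T)
    (hT' : IsSynth e p f T') : T = T' := ext_basis e fun m => by rw [hT, hT']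

lemma norm_inner_synth (f : L2) (m n : ι) :
    ‖⟪tf (p m) f, tf (p n) f⟫_ℂ‖ ≤ ‖⟪tf (p (-(n - m))) f, f⟫_ℂ‖ := by
  rw [norm_inner_tf_tf, neg_sub, map_sub]

lemma exp_gauss_shift_le (w h : ℝ × ℝ) :
    Real.exp (-(Real.pi / 2) * ((w + h).1 ^ 2 + (w + h).2 ^ 2)) ≤
      Real.exp (Real.pi / 2 * (h.1 ^ 2 + h.2 ^ 2)) *
        Real.exp (-(Real.pi / 4) * (w.1 ^ 2 + w.2 ^ 2)) := by
  rw [← Real.exp_add, Real.exp_le_exp]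
  have h1 : 0 ≤ (w.1 + 2 * h.1) ^ 2 + (w.2 + 2 * h.2) ^ 2 := by positivity
  have := mul_nonneg Real.pi_pos.le h1
  simp only [Prod.fst_add, Prod.snd_add]
  nlinarith

lemma norm_inner_tf_gaussL2_shift_le (w h : ℝ × ℝ) : ‖⟪tf (w + h) gaussL2, gaussL2⟫_ℂ‖ ≤
    Real.exp (Real.pi / 2 * (h.1 ^ 2 + h.2 ^ 2)) *
      Real.exp (-(Real.pi / 4) * (w.1 ^ 2 + w.2 ^ 2)) :=
  (norm_inner_tf_gaussL2_le _).trans (exp_gauss_shift_le w h)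

lemma norm_inner_tf_sub_gaussL2_le {h : ℝ × ℝ} (hh : h.1 ^ 2 + h.2 ^ 2 ≤ 2) (w : ℝ × ℝ) :
    ‖⟪tf w (tf h gaussL2 - gaussL2), tf h gaussL2 - gaussL2⟫_ℂ‖ ≤
      4 * Real.exp Real.pi * Real.exp (-(Real.pi / 4) * (w.1 ^ 2 + w.2 ^ 2)) := by
  have hK (k : ℝ × ℝ) (hk : k.1 ^ 2 + k.2 ^ 2 ≤ 2) : ‖⟪tf (w + k) gaussL2, gaussL2⟫_ℂ‖ ≤
      Real.exp Real.pi * Real.exp (-(Real.pi / 4) * (w.1 ^ 2 + w.2 ^ 2)) := by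
    refine (norm_inner_tf_gaussL2_shift_le w k).trans ?_
    gcongr
    nlinarith [Real.pi_pos]
  have e1 : ‖⟪tf w (tf h gaussL2), tf h gaussL2⟫_ℂ‖ = ‖⟪tf (w + 0) gaussL2, gaussL2⟫_ℂ‖ := by
    rw [tf_tf, inner_smul_left, norm_mul, RCLike.norm_conj, Circle.norm_coe, one_mul,
      norm_inner_tf_tf, add_sub_cancel_right, add_zero]
  have e2 : ‖⟪tf w (tf h gaussL2), gaussL2⟫_ℂ‖ = ‖⟪tf (w + h) gaussL2, gaussL2⟫_ℂ‖ := by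
    rw [tf_tf, inner_smul_left, norm_mul, RCLike.norm_conj, Circle.norm_coe, one_mul]
  have e3 : ‖⟪tf w gaussL2, tf h gaussL2⟫_ℂ‖ = ‖⟪tf (w + -h) gaussL2, gaussL2⟫_ℂ‖ := by
    rw [norm_inner_tf_tf, sub_eq_add_neg]
  have h0 := hK 0 (by norm_num)
  have h2 := hK h hh
  have h3 := hK (-h) (by simpa using hh)
  rw [← e1] at h0
  rw [← e2] at h2
  rw [← e3] at h3
  have h4 := hK 0 (by norm_num)
  rw [add_zero] at h4
  have hs : tf w (tf h gaussL2 - gaussL2) = tf w (tf h gaussL2) - tf w gaussL2 :=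
    (tfL w).map_sub _ _
  rw [hs, inner_sub_left, inner_sub_right, inner_sub_right]
  have t1 := norm_sub_le (⟪tf w (tf h gaussL2), tf h gaussL2⟫_ℂ - ⟪tf w (tf h gaussL2), gaussL2⟫_ℂ)
    (⟪tf w gaussL2, tf h gaussL2⟫_ℂ - ⟪tf w gaussL2, gaussL2⟫_ℂ)
  have t2 := norm_sub_le ⟪tf w (tf h gaussL2), tf h gaussL2⟫_ℂ ⟪tf w (tf h gaussL2), gaussL2⟫_ℂ
  have t3 := norm_sub_le ⟪tf w gaussL2, tf h gaussL2⟫_ℂ ⟪tf w gaussL2, gaussL2⟫_ℂ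
  linarith

/-- Gaussian summability along the discrete set `p`. -/
def GaussSummable (p : ι →+ ℝ × ℝ) : Prop :=
  Summable fun m => Real.exp (-(Real.pi / 4) * ((p m).1 ^ 2 + (p m).2 ^ 2))

lemma GaussSummable.of_le {a : ι → ℝ} (hs : GaussSummable p) {K : ℝ} (ha : ∀ m, 0 ≤ a m)
    (h : ∀ m, a m ≤ K * Real.exp (-(Real.pi / 4) * ((p m).1 ^ 2 + (p m).2 ^ 2))) : Summable a :=
  Summable.of_nonneg_of_le ha h (Summable.mul_left K hs)

lemma exists_isSynth_gaussL2 (e : HilbertBasis ι ℂ H) (hs : GaussSummable p) :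
    ∃ T : H →L[ℂ] L2, IsSynth e p gaussL2 T := by
  have hsum : Summable fun m => ‖⟪tf (p (-m)) gaussL2, gaussL2⟫_ℂ‖ := by
    refine hs.of_le (K := 1) (fun _ => norm_nonneg _) fun m => ?_
    have := norm_inner_tf_gaussL2_shift_le (p (-m)) 0
    simpa using this
  obtain ⟨T, hT, -⟩ := exists_synthesis e hsum (fun _ => norm_nonneg _)
    (norm_inner_synth (p := p) gaussL2)
  exact ⟨T, hT⟩

/-- The synthesis operator of the Gabor system generated by `π(x) φ`. -/
def gaussSynth (e : HilbertBasis ι ℂ H) (hs : GaussSummable p) (x : ℝ × ℝ) : H →L[ℂ] L2 :=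
  twist e p x (exists_isSynth_gaussL2 e hs).choose

lemma isSynth_gaussSynth (hs : GaussSummable p) (x : ℝ × ℝ) :
    IsSynth e p (tf x gaussL2) (gaussSynth e hs x) :=
  (exists_isSynth_gaussL2 e hs).choose_spec.twist x

lemma twist_gaussSynth (hs : GaussSummable p) (z x : ℝ × ℝ) :
    twist e p z (gaussSynth e hs x) = (𝐞 (z.2 * x.1) : ℂ) • gaussSynth e hs (z + x) := by
  have h := (isSynth_gaussSynth (e := e) hs x).twist z
  rw [tf_tf] at h
  exact h.unique ((isSynth_gaussSynth hs (z + x)).smul _)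

lemma norm_twist_apply_le (z : ℝ × ℝ) (T : H →L[ℂ] L2) : ‖twist e p z T‖ ≤ ‖T‖ := by
  refine ContinuousLinearMap.opNorm_le_bound _ (norm_nonneg _) fun x => ?_
  rw [twist_apply, norm_tf]
  have h1 := T.le_opNorm (shiftOp e (commChar p z) 0 x)
  have h2 := (shiftOp e (commChar p z) 0).le_of_opNorm_le (norm_shiftOp_le e _ _) x
  rw [one_mul] at h2
  exact h1.trans (by gcongr)

lemma norm_gaussSynth_le (hs : GaussSummable p) (x : ℝ × ℝ) :
    ‖gaussSynth e hs x‖ ≤ ‖(exists_isSynth_gaussL2 e hs).choose‖ := norm_twist_apply_le _ _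

lemma tendsto_gaussSynth_zero (hs : GaussSummable p) :
    Tendsto (gaussSynth e hs) (nhds 0) (nhds (gaussSynth e hs 0)) := by
  set ψ : ℝ × ℝ → L2 := fun h => tf h gaussL2 - gaussL2 with hψ
  have hev : ∀ᶠ h : ℝ × ℝ in nhds 0, h.1 ^ 2 + h.2 ^ 2 ≤ 2 := by
    have hc : Continuous fun h : ℝ × ℝ => h.1 ^ 2 + h.2 ^ 2 := by fun_prop
    have := hc.tendsto 0
    exact (this.eventually_lt_const (by norm_num : (_ : ℝ) < 2)).mono fun _ h => h.le
  have hb : ∀ᶠ h in nhds 0, ∀ m, ‖⟪tf (p (-m)) (ψ h), ψ h⟫_ℂ‖ ≤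
      4 * Real.exp Real.pi * Real.exp (-(Real.pi / 4) * ((p m).1 ^ 2 + (p m).2 ^ 2)) := by
    filter_upwards [hev] with h hh m
    have := norm_inner_tf_sub_gaussL2_le hh (p (-m))
    simpa using this
  have hnorm : ∀ᶠ h in nhds 0, ‖gaussSynth e hs h - gaussSynth e hs 0‖ ^ 2 ≤
      ∑' m, ‖⟪tf (p (-m)) (ψ h), ψ h⟫_ℂ‖ := by
    filter_upwards [hb] with h hh
    refine norm_synthesis_sq_le e (hs.of_le (fun _ => norm_nonneg _) hh) (fun _ => norm_nonneg _)
      (norm_inner_synth (p := p) (ψ h)) ?_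
    have := (isSynth_gaussSynth (e := e) hs h).sub (isSynth_gaussSynth hs 0)
    rwa [tf_zero] at this
  have htsum : Tendsto (fun h => ∑' m, ‖⟪tf (p (-m)) (ψ h), ψ h⟫_ℂ‖) (nhds 0) (nhds 0) := by
    have h0 : Tendsto (fun h => ∑' m, ‖⟪tf (p (-m)) (ψ h), ψ h⟫_ℂ‖) (nhds 0)
        (nhds (∑' _ : ι, (0 : ℝ))) := by
      refine tendsto_tsum_of_dominated_convergence (Summable.mul_left (4 * Real.exp Real.pi) hs)
        (fun m => ?_) (by simpa using hb)
      refine squeeze_zero (fun _ => norm_nonneg _) (fun h => ?_) tendsto_norm_tf_sub_gaussL2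
      refine (norm_inner_le_norm _ _).trans_eq ?_
      rw [norm_tf, sq]
    simpa using h0
  rw [tendsto_iff_norm_sub_tendsto_zero]
  have h2 : Tendsto (fun h => ‖gaussSynth e hs h - gaussSynth e hs 0‖ ^ 2) (nhds 0) (nhds 0) :=
    squeeze_zero' (Eventually.of_forall fun _ => by positivity) hnorm htsum
  simpa [Real.sqrt_sq (norm_nonneg _)] using h2.sqrt

lemma continuous_fourierChar_coe {X : Type*} [TopologicalSpace X] {f : X → ℝ}
    (hf : Continuous f) : Continuous fun x => (𝐞 (f x) : ℂ) :=
  continuous_subtype_val.comp (Real.continuous_fourierChar.comp hf)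

lemma continuous_gaussSynth (hs : GaussSummable p) : Continuous (gaussSynth e hs) := by
  rw [continuous_iff_continuousAt]
  intro x
  have key (h : ℝ × ℝ) : gaussSynth e hs (x + h)
      = (𝐞 (-(x.2 * h.1)) : ℂ) • twist e p x (gaussSynth e hs h) := by
    rw [twist_gaussSynth, smul_smul, ← Circle.coe_mul, ← AddChar.map_add_eq_mul]
    simp
  have h1 : Tendsto (fun h : ℝ × ℝ => (𝐞 (-(x.2 * h.1)) : ℂ) • twist e p x (gaussSynth e hs h))
      (nhds 0) (nhds ((𝐞 (-(x.2 * (0 : ℝ × ℝ).1)) : ℂ) • twist e p x (gaussSynth e hs 0))) :=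
    ((continuous_fourierChar_coe (by fun_prop)).tendsto 0).smul
      (((twist e p x).continuous.tendsto _).comp (tendsto_gaussSynth_zero hs))
  rw [← key] at h1
  simp_rw [← key] at h1
  have h2 : Tendsto (fun y => y - x) (nhds x) (nhds 0) := by
    have := (continuous_sub_right x).tendsto x
    rwa [sub_self] at this
  have := h1.comp h2
  simpa [Function.comp_def, ContinuousAt] using this

/-- The closed subspace of synthesis operators spanned by Gaussian ones. -/
def synthSpace (e : HilbertBasis ι ℂ H) (hs : GaussSummable p) : Submodule ℂ (H →L[ℂ] L2) :=
  (Submodule.span ℂ (Set.range (gaussSynth e hs))).topologicalClosure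

lemma isClosed_synthSpace (hs : GaussSummable p) :
    IsClosed (synthSpace e hs : Set (H →L[ℂ] L2)) :=
  Submodule.isClosed_topologicalClosure _

lemma gaussSynth_mem_synthSpace (hs : GaussSummable p) (x : ℝ × ℝ) :
    gaussSynth e hs x ∈ synthSpace e hs :=
  Submodule.le_topologicalClosure _ (Submodule.subset_span ⟨x, rfl⟩)

lemma twist_mem_synthSpace (hs : GaussSummable p) (z : ℝ × ℝ) {T : H →L[ℂ] L2}
    (hT : T ∈ synthSpace e hs) : twist e p z T ∈ synthSpace e hs := by
  refine map_mem_closure (twist e p z).continuous hT fun S hS => ?_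
  induction hS using Submodule.span_induction with
  | mem S hS =>
    obtain ⟨x, rfl⟩ := hS
    rw [twist_gaussSynth]
    exact Submodule.smul_mem _ _ (Submodule.subset_span ⟨_, rfl⟩)
  | zero => rw [map_zero]; exact zero_mem _
  | add S T _ _ hS hT => rw [map_add]; exact add_mem hS hT
  | smul r S _ hS => rw [map_smul]; exact Submodule.smul_mem _ _ hS

lemma entry_adjoint_comp {f f' : L2} {T T' : H →L[ℂ] L2} (hT : IsSynth e p f T)
    (hT' : IsSynth e p f' T') (m n : ι) :
    entry e ((ContinuousLinearMap.adjoint T).comp T') m n = ⟪tf (p m) f, tf (p n) f'⟫_ℂ := by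
  rw [entry, ContinuousLinearMap.comp_apply, ContinuousLinearMap.adjoint_inner_right, hT, hT']

lemma adjoint_comp_mem_covariantAlgebra {f f' : L2} {T T' : H →L[ℂ] L2} (hT : IsSynth e p f T)
    (hT' : IsSynth e p f' T') :
    (ContinuousLinearMap.adjoint T).comp T' ∈ covariantAlgebra e (cocycle p) := by
  have h (l m : ι) (f : L2) : tf (p (l + m)) f
      = ((cocycle p l m)⁻¹ : Circle) • tf (p l) (tf (p m) f) := by
    rw [map_add, tf_add_eq, cocycle, ← AddChar.map_neg_eq_inv, Circle.smul_def]
  intro l m n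
  rw [entry_adjoint_comp hT hT', entry_adjoint_comp hT hT', h, h, Circle.smul_def, Circle.smul_def,
    inner_smul_left, inner_smul_right, inner_tf_tf, ← Circle.coe_inv_eq_conj, inv_inv, ← mul_assoc,
    ← Circle.coe_mul, div_eq_mul_inv]

lemma adjoint_gaussSynth_comp_mem (ℓ : ι →+ ℝ) (hs : GaussSummable p) (x y : ℝ × ℝ) :
    (ContinuousLinearMap.adjoint (gaussSynth e hs x)).comp (gaussSynth e hs y)
      ∈ torusAlgebra e (cocycle p) ℓ := by
  have hx := isSynth_gaussSynth (e := e) hs x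
  have hy := isSynth_gaussSynth (e := e) hs y
  refine mem_torusAlgebra_of_summable e ℓ (cocycle_add_left p) (cocycle_add_right p)
    (adjoint_comp_mem_covariantAlgebra hx hy) ?_
  refine hs.of_le (K := Real.exp (Real.pi / 2 * ((x - y).1 ^ 2 + (x - y).2 ^ 2)))
    (fun _ => norm_nonneg _) fun m => ?_
  rw [entry_adjoint_comp hx hy, map_zero, tf_zero, tf_tf, inner_smul_left, norm_mul,
    RCLike.norm_conj, Circle.norm_coe, one_mul, norm_inner_tf_tf, add_sub_assoc]
  exact norm_inner_tf_gaussL2_shift_le (p m) (x - y)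

lemma adjoint_comp_mem_torusAlgebra (ℓ : ι →+ ℝ) (hs : GaussSummable p) {S T : H →L[ℂ] L2}
    (hS : S ∈ synthSpace e hs) (hT : T ∈ synthSpace e hs) :
    (ContinuousLinearMap.adjoint S).comp T ∈ torusAlgebra e (cocycle p) ℓ := by
  have hc : Continuous (Function.uncurry fun S T : H →L[ℂ] L2 =>
      (ContinuousLinearMap.adjoint S).comp T) :=
    ((ContinuousLinearMap.adjoint (𝕜 := ℂ) (E := H) (F := L2)).continuous.comp
      continuous_fst).clm_comp continuous_snd
  rw [← SetLike.mem_coe, ← (isClosed_torusAlgebra e (cocycle p) ℓ).closure_eq]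
  refine map_mem_closure₂
    (f := fun S T : H →L[ℂ] L2 => (ContinuousLinearMap.adjoint S).comp T) hc hS hT fun S hS T hT => ?_
  refine Submodule.span_induction₂ (p := fun S T _ _ => (ContinuousLinearMap.adjoint S).comp T ∈
    torusAlgebra e (cocycle p) ℓ) ?_ ?_ ?_ ?_ ?_ ?_ ?_ hS hT
  · rintro _ _ ⟨x, rfl⟩ ⟨y, rfl⟩
    exact adjoint_gaussSynth_comp_mem ℓ hs x y
  · intro y _; simp [zero_mem]
  · intro x _; simp [zero_mem]
  · intro x y z _ _ _ h1 h2
    rw [map_add, ContinuousLinearMap.add_comp]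
    exact add_mem h1 h2
  · intro x y z _ _ _ h1 h2
    rw [ContinuousLinearMap.comp_add]
    exact add_mem h1 h2
  · intro r x y _ _ h1
    rw [map_smulₛₗ, ContinuousLinearMap.smul_comp]
    exact SMulMemClass.smul_mem _ h1
  · intro r x y _ _ h1
    rw [ContinuousLinearMap.comp_smul]
    exact SMulMemClass.smul_mem _ h1

end GaborSynthesis

section Stabilizer

open scoped FourierTransform

set_option linter.unusedSectionVars false

variable {ι : Type*} [AddCommGroup ι] {H : Type*} [NormedAddCommGroup H] [InnerProductSpace ℂ H]
  [CompleteSpace H] {e : HilbertBasis ι ℂ H} {p : ι →+ ℝ × ℝ}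

lemma integral_mem_of_isClosed {E : Type*} [NormedAddCommGroup E] [NormedSpace ℂ E]
    [CompleteSpace E] {α : Type*} [MeasurableSpace α] {μ : Measure α} (K : Submodule ℂ E)
    (hK : IsClosed (K : Set E)) {f : α → E} (hf : Integrable f μ) (h : ∀ x, f x ∈ K) :
    ∫ x, f x ∂μ ∈ K := by
  have : IsClosed (K : Set E) := hK
  let q : E →L[ℂ] E ⧸ K := K.mkQL
  have h1 : q (∫ x, f x ∂μ) = 0 := by
    rw [← q.integral_comp_comm hf]
    have : ∀ x, q (f x) = 0 := fun x => (Submodule.Quotient.mk_eq_zero K).mpr (h x)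
    simp [this]
  exact (Submodule.Quotient.mk_eq_zero K).mp h1

/-- Synthesis operators of windows in the Feichtinger algebra are norm limits of combinations of
Gaussian ones, and time-frequency shifts act on them norm continuously. -/
lemma exists_isSynth (e : HilbertBasis ι ℂ H) (hs : GaussSummable p) {g : L2} (hg : InS0 g) :
    ∃ T : H →L[ℂ] L2, IsSynth e p g T ∧ T ∈ synthSpace e hs ∧
      Tendsto (fun z => twist e p z T) (nhds 0) (nhds T) := by
  set κ : ℂ := ((‖gaussL2‖ ^ 2 : ℝ) : ℂ) with hκ
  have hκ0 : κ ≠ 0 := by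
    rw [hκ, Complex.ofReal_ne_zero]
    exact pow_ne_zero _ (norm_ne_zero_iff.mpr gaussL2_ne_zero)
  set V : ℝ × ℝ → ℂ := fun x => ⟪tf x gaussL2, g⟫_ℂ
  set C := ‖(exists_isSynth_gaussL2 e hs).choose‖
  have hbd : ∀ x, ‖gaussSynth e hs x‖ ≤ C := norm_gaussSynth_le hs
  have hcont := continuous_gaussSynth (e := e) hs
  have hint : Integrable fun x => V x • gaussSynth e hs x :=
    hg.smul_bdd C hcont.aestronglyMeasurable (Eventually.of_forall hbd)
  refine ⟨κ⁻¹ • ∫ x, V x • gaussSynth e hs x, fun m => ?_, ?_, ?_⟩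
  · have h1 : (∫ x, V x • gaussSynth e hs x) (e m) = κ • tf (p m) g := by
      rw [ContinuousLinearMap.integral_apply hint]
      have h2 (x : ℝ × ℝ) : (V x • gaussSynth e hs x) (e m)
          = (tfL (p m)).toContinuousLinearMap (V x • tf x gaussL2) := by
        rw [map_smul, smul_apply, isSynth_gaussSynth hs x m]
        rfl
      simp_rw [h2]
      rw [ContinuousLinearMap.integral_comp_comm _ (integrable_smul_tf_gaussL2 hg),
        integral_smul_tf_gaussL2 hg, map_smul]
      rfl
    rw [smul_apply, h1, inv_smul_smul₀ hκ0]
  · exact Submodule.smul_mem _ _ (integral_mem_of_isClosed _ (isClosed_synthSpace hs) hint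
      fun x => Submodule.smul_mem _ _ (gaussSynth_mem_synthSpace hs x))
  · simp_rw [map_smul]
    refine Tendsto.const_smul ?_ _
    have h1 (z : ℝ × ℝ) : twist e p z (∫ x, V x • gaussSynth e hs x)
        = ∫ x, V x • ((𝐞 (z.2 * x.1) : ℂ) • gaussSynth e hs (z + x)) := by
      rw [← ContinuousLinearMap.integral_comp_comm _ hint]
      simp_rw [map_smul, twist_gaussSynth]
    simp_rw [h1]
    refine tendsto_integral_filter_of_dominated_convergence (fun x => ‖V x‖ * C) ?_ ?_
      (hg.norm.mul_const C) ?_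
    · refine Eventually.of_forall fun z => hg.aestronglyMeasurable.smul ?_
      exact ((continuous_fourierChar_coe (f := fun x : ℝ × ℝ => z.2 * x.1) (by fun_prop)).smul
        (hcont.comp (continuous_const_add z))).aestronglyMeasurable
    · refine Eventually.of_forall fun z => Eventually.of_forall fun x => ?_
      rw [norm_smul, norm_smul, Circle.norm_coe, one_mul]
      gcongr
      exact hbd _
    · refine Eventually.of_forall fun x => ?_
      have hc : Continuous fun z : ℝ × ℝ => V x • ((𝐞 (z.2 * x.1) : ℂ) • gaussSynth e hs (z + x)) :=
        ((continuous_fourierChar_coe (f := fun z : ℝ × ℝ => z.2 * x.1)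
          (by fun_prop)).smul (hcont.comp (continuous_add_const x))).const_smul (V x)
      have := hc.tendsto 0
      simpa using this

/-- The closed span of a Gabor system as a submodule. -/
def gaborSubmodule (g : L2) (Λ : Set (ℝ × ℝ)) : Submodule ℂ L2 :=
  (Submodule.span ℂ ((fun z => tf z g) '' Λ)).topologicalClosure

lemma add_mem_stab {g : L2} {Λ : Set (ℝ × ℝ)} {z w : ℝ × ℝ} (hz : z ∈ stab (gaborSpan g Λ))
    (hw : w ∈ stab (gaborSpan g Λ)) : z + w ∈ stab (gaborSpan g Λ) := by
  intro f hf
  rw [tf_add_eq]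
  exact (gaborSubmodule g Λ).smul_mem _ (hz _ (hw _ hf))

lemma mem_stab_of_mem {g : L2} (s : ι) : p s ∈ stab (gaborSpan g (Set.range p)) := by
  intro f hf
  refine map_mem_closure (tfL (p s)).continuous hf fun f hf => ?_
  induction hf using Submodule.span_induction with
  | mem f hf =>
    obtain ⟨_, ⟨m, rfl⟩, rfl⟩ := hf
    change tf (p s) (tf (p m) g) ∈ _
    rw [tf_tf, ← map_add]
    exact Submodule.smul_mem _ _ (Submodule.subset_span ⟨_, ⟨_, rfl⟩, rfl⟩)
  | zero => rw [← tfL_apply, map_zero]; exact zero_mem _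
  | add S T _ _ hS hT => rw [tf_add]; exact add_mem hS hT
  | smul r S _ hS => rw [tf_smul]; exact Submodule.smul_mem _ _ hS

lemma norm_finsupp_sum_basis_sq (e : HilbertBasis ι ℂ H) (b : ι →₀ ℂ) :
    ‖b.sum fun m r => r • e m‖ ^ 2 = b.sum fun _ r => ‖r‖ ^ 2 := by
  have h : ((‖b.sum fun m r => r • e m‖ ^ 2 : ℝ) : ℂ) = ((b.sum fun _ r => ‖r‖ ^ 2 : ℝ) : ℂ) := by
    have := inner_self_eq_norm_sq_to_K (𝕜 := ℂ) (b.sum fun m r => r • e m)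
    rw [Complex.ofReal_pow]
    refine this.symm.trans ?_
    rw [Finsupp.sum, e.orthonormal.inner_sum, Finsupp.sum]
    push_cast
    refine Finset.sum_congr rfl fun m _ => ?_
    rw [mul_comm, Complex.mul_conj']
  exact_mod_cast h

lemma IsSynth.bounded_below {g : L2} {T : H →L[ℂ] L2} (hT : IsSynth e p g T)
    (hp : Function.Injective p) (hriesz : IsRieszSeq g (Set.range p)) :
    ∃ A : ℝ, 0 < A ∧ ∀ x, A * ‖x‖ ^ 2 ≤ ‖T x‖ ^ 2 := by
  obtain ⟨A, B, hA, -, h⟩ := hriesz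
  refine ⟨A, hA, fun x => ?_⟩
  have hcl : IsClosed {x | A * ‖x‖ ^ 2 ≤ ‖T x‖ ^ 2} :=
    isClosed_le (by fun_prop) (by fun_prop)
  have hx : x ∈ closure (Submodule.span ℂ (Set.range e) : Set H) := by
    have := e.dense_span
    rw [← Submodule.topologicalClosure_coe, this]
    trivial
  refine hcl.closure_subset_iff.mpr (fun y hy => ?_) hx
  obtain ⟨b, rfl⟩ := Finsupp.mem_span_range_iff_exists_finsupp.mp hy
  have hinj : Function.Injective (Set.rangeFactorization p) := fun a b hab =>
    hp (congrArg Subtype.val hab)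
  have h1 := (h (b.mapDomain (Set.rangeFactorization p))).1
  have e1 : ∑ lam ∈ (b.mapDomain (Set.rangeFactorization p)).support,
      ‖b.mapDomain (Set.rangeFactorization p) lam‖ ^ 2 = b.sum fun _ r => ‖r‖ ^ 2 :=
    Finsupp.sum_mapDomain_index_inj (h := fun _ r => ‖r‖ ^ 2) hinj
  have e2 : ∑ lam ∈ (b.mapDomain (Set.rangeFactorization p)).support,
      b.mapDomain (Set.rangeFactorization p) lam • tf (lam : ℝ × ℝ) g
        = b.sum fun m r => r • tf (p m) g :=
    Finsupp.sum_mapDomain_index_inj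
      (h := fun (lam : Set.range p) (r : ℂ) => r • tf (lam : ℝ × ℝ) g) hinj
  have e3 : T (b.sum fun m r => r • e m) = b.sum fun m r => r • tf (p m) g := by
    rw [map_finsuppSum]
    simp_rw [map_smul]
    exact Finset.sum_congr rfl fun m _ => congrArg (b m • ·) (hT m)
  rw [e1, e2] at h1
  rw [Set.mem_ofPred_eq, norm_finsupp_sum_basis_sq, e3]
  exact h1

lemma IsSynth.range_eq {g : L2} {T : H →L[ℂ] L2} (hT : IsSynth e p g T) {A : ℝ} (hA : 0 < A)
    (hb : ∀ x, A * ‖x‖ ^ 2 ≤ ‖T x‖ ^ 2) : Set.range T = gaborSpan g (Set.range p) := by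
  have hanti : AntilipschitzWith (Real.toNNReal (√A)⁻¹) T := by
    refine ContinuousLinearMap.antilipschitz_of_bound T fun x => ?_
    rw [Real.coe_toNNReal _ (by positivity), inv_mul_eq_div, le_div_iff₀ (by positivity)]
    refine abs_le_of_sq_le_sq' ?_ (norm_nonneg _) |>.2
    rw [mul_pow, Real.sq_sqrt hA.le, mul_comm]
    exact hb x
  have hcl : IsClosed (Set.range T) := hanti.isClosed_range T.uniformContinuous
  refine subset_antisymm ?_ ?_
  · rintro _ ⟨x, rfl⟩
    have hx : x ∈ closure (Submodule.span ℂ (Set.range e) : Set H) := by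
      have := e.dense_span
      rw [← Submodule.topologicalClosure_coe, this]
      trivial
    refine map_mem_closure T.continuous hx fun y hy => ?_
    induction hy using Submodule.span_induction with
    | mem f hf =>
      obtain ⟨m, rfl⟩ := hf
      rw [hT]
      exact Submodule.subset_span ⟨_, ⟨m, rfl⟩, rfl⟩
    | zero => rw [map_zero]; exact zero_mem _
    | add S T _ _ hS hT => rw [map_add]; exact add_mem hS hT
    | smul r S _ hS => rw [map_smul]; exact Submodule.smul_mem _ _ hS
  · refine closure_minimal ?_ hcl
    have : Submodule.span ℂ ((fun z => tf z g) '' Set.range p) ≤ LinearMap.range T.toLinearMap := by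
      rw [Submodule.span_le]
      rintro _ ⟨_, ⟨m, rfl⟩, rfl⟩
      exact ⟨e m, hT m⟩
    exact this

end Stabilizer

section Cocycle

open scoped FourierTransform

variable {ι : Type*} [AddCommGroup ι] {H : Type*} [NormedAddCommGroup H] [InnerProductSpace ℂ H]
  [CompleteSpace H] {e : HilbertBasis ι ℂ H} {p : ι →+ ℝ × ℝ}

/-- The coefficient operators of time-frequency shifts on a Riesz sequence with window in the
Feichtinger algebra: they lie in the torus algebra, depend continuously on the shift at the origin
and form a twisted cocycle on the stabilizer of the span. -/
lemma exists_coefficient_cocycle (e : HilbertBasis ι ℂ H) (hs : GaussSummable p)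
    (hp : Function.Injective p) {g : L2} (hg : InS0 g) (hriesz : IsRieszSeq g (Set.range p)) :
    ∃ u : ℝ × ℝ → H →L[ℂ] H,
      (∀ ℓ z, u z ∈ torusAlgebra e (cocycle p) ℓ) ∧ Tendsto u (nhds 0) (nhds 1) ∧
      (∀ z ∈ stab (gaborSpan g (Set.range p)), ∀ w ∈ stab (gaborSpan g (Set.range p)),
        ∃ θ : Circle, u (z + w) = (θ : ℂ) • (u z *
          (star (shiftOp e (commChar p z) 0) * u w * shiftOp e (commChar p z) 0))) ∧
      ∀ s, u (p s) = shiftOp e (fun m => cocycle p m s) s := by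
  obtain ⟨T, hT, hTmem, hTlim⟩ := exists_isSynth e hs hg
  obtain ⟨A, hA, hb⟩ := hT.bounded_below hp hriesz
  have hrange := hT.range_eq hA hb
  set G : H →L[ℂ] H := (ContinuousLinearMap.adjoint T).comp T with hG
  have hGunit : IsUnit G := by
    refine ContinuousLinearMap.isUnit_of_forall_le_norm_inner_map G (c := ⟨A, hA.le⟩) hA fun x => ?_
    rw [hG, ContinuousLinearMap.comp_apply, ContinuousLinearMap.adjoint_inner_left,
      inner_self_eq_norm_sq_to_K, norm_pow, RCLike.norm_ofReal, abs_norm, mul_comm]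
    exact hb x
  obtain ⟨K, hGK, hKG⟩ : ∃ K, G * K = 1 ∧ K * G = 1 := isUnit_iff_exists.mp hGunit
  have hKT (S : H →L[ℂ] H) : K * (ContinuousLinearMap.adjoint T).comp (T.comp S) = S :=
    calc _ = K * G * S := rfl
      _ = S := by rw [hKG, one_mul]
  set u : ℝ × ℝ → H →L[ℂ] H :=
    fun z => K * (ContinuousLinearMap.adjoint T).comp (twist e p z T) with hu
  have hTu {z : ℝ × ℝ} (hz : z ∈ stab (gaborSpan g (Set.range p))) :
      T.comp (u z) = twist e p z T := by
    ext1 x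
    have hx : twist e p z T x ∈ Set.range T := by
      rw [hrange, twist_apply]
      exact hz _ (hrange ▸ Set.mem_range_self _)
    obtain ⟨y, hy⟩ := hx
    have h1 : u z x = y := by
      calc u z x = K (ContinuousLinearMap.adjoint T (twist e p z T x)) := rfl
        _ = (K * G) y := by rw [← hy]; rfl
        _ = y := by rw [hKG]; rfl
    rw [ContinuousLinearMap.comp_apply, h1, hy]
  have hTinj {S : H →L[ℂ] H} {z : ℝ × ℝ} (h : T.comp S = twist e p z T) : u z = S := by
    rw [hu]
    simp only
    rw [← h, hKT]
  refine ⟨u, fun ℓ z => ?_, ?_, fun z hz w hw => ?_, fun s => hTinj ?_⟩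
  · have hGmem : G ∈ torusAlgebra e (cocycle p) ℓ := adjoint_comp_mem_torusAlgebra ℓ hs hTmem hTmem
    exact mul_mem (mem_of_mul_eq_one _ (isClosed_torusAlgebra e _ ℓ) hGmem hGK hKG)
      (adjoint_comp_mem_torusAlgebra ℓ hs hTmem (twist_mem_synthSpace hs z hTmem))
  · have hc : Continuous fun S : H →L[ℂ] L2 => K * (ContinuousLinearMap.adjoint T).comp S :=
      continuous_const.mul ((ContinuousLinearMap.compL ℂ H L2 H
        (ContinuousLinearMap.adjoint T)).continuous)
    have := (hc.tendsto T).comp hTlim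
    rwa [← hG, hKG] at this
  · refine ⟨𝐞 (-(z.2 * w.1)), hTinj ?_⟩
    set D := shiftOp e (commChar p z) 0 with hD
    have h1 : twist e p (z + w) T = (𝐞 (-(z.2 * w.1)) : ℂ) • twist e p z (twist e p w T) := by
      refine (hT.twist (z + w)).unique ?_
      rw [tf_add_eq]
      exact ((hT.twist w).twist z).smul _
    rw [h1, ContinuousLinearMap.comp_smul]
    congr 1
    calc T.comp (u z * (star D * u w * D))
        = (T.comp (u z)).comp (star D * u w * D) := rfl
      _ = (tfL z).toContinuousLinearMap.comp (T.comp ((D * star D) * (u w * D))) := by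
        rw [hTu hz]; rfl
      _ = (tfL z).toContinuousLinearMap.comp ((T.comp (u w)).comp D) := by
        rw [hD, shiftOp_mul_star_self, one_mul]; rfl
      _ = twist e p z (twist e p w T) := by rw [hTu hw]; rfl
  · refine ext_basis e fun m => ?_
    rw [hT.twist (p s) m, ContinuousLinearMap.comp_apply, shiftOp_apply, map_smul, hT, tf_tf,
      map_add]
    rfl

end Cocycle

section Rigidity

variable {ι : Type*} [AddCommGroup ι] {H : Type*} [NormedAddCommGroup H] [InnerProductSpace ℂ H]
  [CompleteSpace H] {e : HilbertBasis ι ℂ H} {p : ι →+ ℝ × ℝ}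

lemma norm_one_sub_conj_shiftOp_le (e : HilbertBasis ι ℂ H) (d : ι → Circle) (x : H →L[ℂ] H) :
    ‖1 - star (shiftOp e d 0) * x * shiftOp e d 0‖ ≤ ‖1 - x‖ := by
  set D := shiftOp e d 0 with hD
  have h1 : 1 - star D * x * D = star D * (1 - x) * D := by
    rw [mul_sub, sub_mul, mul_one, hD, star_shiftOp_mul_self]
  have hD1 : ‖D‖ ≤ 1 := norm_shiftOp_le e d 0
  rw [h1]
  calc ‖star D * (1 - x) * D‖ ≤ ‖star D‖ * ‖1 - x‖ * ‖D‖ :=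
        (norm_mul_le _ _).trans (by gcongr; exact norm_mul_le _ _)
    _ ≤ 1 * ‖1 - x‖ * 1 := by rw [norm_star]; gcongr
    _ = ‖1 - x‖ := by ring

lemma norm_one_sub_inv_lt {v y : H →L[ℂ] H} (hv : ‖1 - v‖ < 1 / 2) (hy : y * v = 1) :
    ‖1 - y‖ < 1 := by
  have h1 : 1 - y = (1 - y) * (1 - v) - (1 - v) := by
    rw [sub_mul, mul_sub y, hy]; simp
  have h2 : ‖1 - y‖ ≤ ‖1 - y‖ * ‖1 - v‖ + ‖1 - v‖ := by
    calc ‖1 - y‖ = ‖(1 - y) * (1 - v) - (1 - v)‖ := by rw [← h1]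
      _ ≤ _ := (norm_sub_le _ _).trans (by gcongr; exact norm_mul_le _ _)
  nlinarith [norm_nonneg (1 - y)]

/-- Multiples of a short stabilizing shift cannot come close to nonzero lattice points. -/
lemma exists_forall_nsmul_near_lattice (e : HilbertBasis ι ℂ H) (hs : GaussSummable p)
    (hp : Function.Injective p) (hsep : ∀ s : ι, s ≠ 0 → ∃ ℓ : ι →+ ℝ, ℓ s ≠ 0) {g : L2}
    (hg : InS0 g) (hriesz : IsRieszSeq g (Set.range p)) :
    ∃ ε : ℝ, 0 < ε ∧ ∀ w ∈ stab (gaborSpan g (Set.range p)), ‖w‖ < ε → ∀ n : ℕ, 1 ≤ n → ∀ s : ι,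
      ∀ r ∈ stab (gaborSpan g (Set.range p)), ‖r‖ < ε → n • w = p s + r → s = 0 := by
  obtain ⟨u, hu, hlim, hcoc, hlat⟩ := exists_coefficient_cocycle e hs hp hg hriesz
  obtain ⟨ε, hε, hball⟩ := Metric.tendsto_nhds_nhds.mp hlim (1 / 2) (by norm_num)
  refine ⟨ε, hε, fun w hw hwε n hn s r hr hrε hnw => ?_⟩
  by_contra hs0
  obtain ⟨ℓ, hℓ⟩ := hsep s hs0
  have hsmall {z : ℝ × ℝ} (hz : ‖z‖ < ε) : ‖1 - u z‖ < 1 / 2 := by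
    rw [norm_sub_rev, ← dist_eq_norm]
    exact hball (by simpa using hz)
  have hmul (n : ℕ) : (n + 1) • w ∈ stab (gaborSpan g (Set.range p)) ∧
      u ((n + 1) • w) ∈ (zeroWinding e (cocycle p) ℓ).topologicalClosure := by
    induction n with
    | zero =>
      simp only [zero_add, one_smul]
      exact ⟨hw, mem_closure_zeroWinding_of_norm_lt (hu ℓ w)
        ((hsmall hwε).trans (by norm_num))⟩
    | succ n ih =>
      rw [succ_nsmul _ (n + 1)]
      refine ⟨add_mem_stab ih.1 hw, ?_⟩
      obtain ⟨θ, hθ⟩ := hcoc _ ih.1 w hw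
      rw [hθ]
      refine smul_mem_closure_zeroWinding (mul_mem ih.2 ?_) θ
      refine mem_closure_zeroWinding_of_norm_lt
        (conj_shiftOp_mem_torusAlgebra e ℓ (commChar_add p _) (hu ℓ w)) ?_
      exact (norm_one_sub_conj_shiftOp_le e _ _).trans_lt ((hsmall hwε).trans (by norm_num))
  obtain ⟨n, rfl⟩ := Nat.exists_eq_add_of_le' hn
  have hps : p s ∈ stab (gaborSpan g (Set.range p)) := mem_stab_of_mem s
  obtain ⟨θ, hθ⟩ := hcoc _ hps r hr
  rw [← hnw] at hθ
  set v := star (shiftOp e (commChar p (p s)) 0) * u r * shiftOp e (commChar p (p s)) 0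
  have hvmem : v ∈ torusAlgebra e (cocycle p) ℓ :=
    conj_shiftOp_mem_torusAlgebra e ℓ (commChar_add p _) (hu ℓ r)
  have hv : ‖1 - v‖ < 1 / 2 := (norm_one_sub_conj_shiftOp_le e _ _).trans_lt (hsmall hrε)
  obtain ⟨y, hvy, hyv⟩ := exists_inverse_of_norm_lt (hv.trans (by norm_num))
  have hy : y ∈ (zeroWinding e (cocycle p) ℓ).topologicalClosure :=
    mem_closure_zeroWinding_of_norm_lt
      (mem_of_mul_eq_one _ (isClosed_torusAlgebra e _ ℓ) hvmem hvy hyv)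
      (norm_one_sub_inv_lt hv hyv)
  have key : u (p s) = ((θ⁻¹ : Circle) : ℂ) • (u ((n + 1) • w) * y) := by
    rw [hθ, smul_mul_assoc, mul_assoc, hvy, mul_one, smul_smul, ← Circle.coe_mul]
    simp
  refine shiftOp_notMem_closure_zeroWinding e ℓ (cocycle_add_left p) (cocycle_add_right p) hℓ ?_
  rw [← hlat, key]
  exact smul_mem_closure_zeroWinding (mul_mem (hmul n).2 hy) _

lemma exists_close_pair {E : Type*} [NormedAddCommGroup E] [ProperSpace E] (R : ℝ) {ε : ℝ}
    (hε : 0 < ε) : ∃ K : ℕ, ∀ r : ℕ → E, (∀ k, ‖r k‖ ≤ R) →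
      ∃ k k', k < k' ∧ k' ≤ K ∧ ‖r k' - r k‖ < ε := by
  obtain ⟨t, -, htfin, hcov⟩ := (isCompact_closedBall (0 : E) R).finite_cover_balls (half_pos hε)
  lift t to Finset E using htfin
  refine ⟨t.card, fun r hr => ?_⟩
  have hex (k : ℕ) : ∃ x ∈ t, dist (r k) x < ε / 2 := by
    have := hcov (mem_closedBall_zero_iff.mpr (hr k))
    simpa using this
  choose c hct hc using hex
  obtain ⟨k, hk, k', hk', hne, heq⟩ := Finset.exists_ne_map_eq_of_card_lt_of_maps_to
    (s := Finset.range (t.card + 1)) (t := t) (f := c) (by simp) (fun k _ => hct k)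
  have hd : dist (r k') (r k) < ε := by
    have h1 := hc k
    have h2 := hc k'
    rw [← heq] at h2
    linarith [dist_triangle_right (r k') (r k) (c k)]
  rw [Finset.mem_range, Nat.lt_succ_iff] at hk hk'
  rcases hne.lt_or_gt with h | h
  · exact ⟨k, k', h, hk', by rwa [← dist_eq_norm]⟩
  · exact ⟨k', k, h, hk, by rwa [← dist_eq_norm, dist_comm]⟩

/-- If the lattice is cocompact, multiples of any vector return close to the lattice at bounded
times. -/
lemma exists_nsmul_near_lattice {R : ℝ} (hR : ∀ z, ∃ s, ‖z - p s‖ ≤ R) {ε : ℝ} (hε : 0 < ε) :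
    ∃ K : ℕ, ∀ z, ∃ n, 1 ≤ n ∧ n ≤ K ∧ ∃ s, ‖n • z - p s‖ < ε := by
  obtain ⟨K, hK⟩ := exists_close_pair (E := ℝ × ℝ) R hε
  refine ⟨K, fun z => ?_⟩
  choose c hc using hR
  obtain ⟨k, k', hlt, hle, h⟩ := hK (fun k => k • z - p (c (k • z))) fun k => hc _
  refine ⟨k' - k, by omega, by omega, c (k' • z) - c (k • z), ?_⟩
  have : (k' - k) • z - p (c (k' • z) - c (k • z)) =
      k' • z - p (c (k' • z)) - (k • z - p (c (k • z))) := by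
    rw [map_sub, sub_nsmul _ hlt.le]
    abel
  rw [this]
  exact h

lemma nsmul_mem_stab {g : L2} {z : ℝ × ℝ} (hz : z ∈ stab (gaborSpan g (Set.range p))) (n : ℕ) :
    n • z ∈ stab (gaborSpan g (Set.range p)) := by
  induction n with
  | zero =>
    rw [zero_smul, ← map_zero p]
    exact mem_stab_of_mem 0
  | succ n ih => rw [succ_nsmul]; exact add_mem_stab ih hz

lemma exists_nsmul_mem_lattice (e : HilbertBasis ι ℂ H) (hs : GaussSummable p)
    (hp : Function.Injective p) (hsep : ∀ s : ι, s ≠ 0 → ∃ ℓ : ι →+ ℝ, ℓ s ≠ 0)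
    {R : ℝ} (hR : ∀ z, ∃ s, ‖z - p s‖ ≤ R) {g : L2}
    (hg : InS0 g) (hriesz : IsRieszSeq g (Set.range p)) :
    ∃ m : ℕ, 1 ≤ m ∧ ∀ z ∈ stab (gaborSpan g (Set.range p)), ∃ s, m • z = p s := by
  obtain ⟨ε, hε, hrig⟩ := exists_forall_nsmul_near_lattice e hs hp hsep hg hriesz
  obtain ⟨K, hK⟩ := exists_nsmul_near_lattice hR hε
  have hrem {z : ℝ × ℝ} (hz : z ∈ stab (gaborSpan g (Set.range p))) (n : ℕ) (s : ι) :
      n • z - p s ∈ stab (gaborSpan g (Set.range p)) := by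
    rw [sub_eq_add_neg, ← map_neg]
    exact add_mem_stab (nsmul_mem_stab hz n) (mem_stab_of_mem _)
  have hdisc {w : ℝ × ℝ} (hw : w ∈ stab (gaborSpan g (Set.range p))) (hwε : ‖w‖ < ε) : w = 0 := by
    by_contra hw0
    have hwpos : 0 < ‖w‖ := norm_pos_iff.mpr hw0
    obtain ⟨N, hN⟩ := exists_nat_ge (ε / ‖w‖)
    rw [div_le_iff₀ hwpos] at hN
    have hN1 : 1 ≤ N := by
      rw [Nat.one_le_iff_ne_zero]
      rintro rfl
      simp at hN
      linarith
    obtain ⟨n, hn1, -, s, hns⟩ := hK (N • w)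
    rw [← mul_nsmul'] at hns
    have hs0 : s = 0 := hrig w hw hwε (n * N) (Nat.mul_pos hn1 hN1) s _ (hrem hw _ s) hns
      (by abel)
    rw [hs0, map_zero, sub_zero, ← Nat.cast_smul_eq_nsmul ℝ, norm_smul, Real.norm_natCast,
      Nat.cast_mul, mul_assoc] at hns
    have : (1 : ℝ) ≤ n := by exact_mod_cast hn1
    nlinarith
  refine ⟨K.factorial, K.factorial_pos, fun z hz => ?_⟩
  obtain ⟨n, hn1, hnK, s, hns⟩ := hK z
  have h0 : n • z = p s := sub_eq_zero.mp (hdisc (hrem hz n s) hns)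
  obtain ⟨q, hq⟩ := Nat.dvd_factorial hn1 hnK
  exact ⟨q • s, by rw [hq, mul_nsmul, h0, map_nsmul]⟩

end Rigidity

section Lattice

/-- The parametrization of the lattice `Aℤ²`. -/
def latticeHom (A : Matrix (Fin 2) (Fin 2) ℝ) : ℤ × ℤ →+ ℝ × ℝ where
  toFun m := (A 0 0 * m.1 + A 0 1 * m.2, A 1 0 * m.1 + A 1 1 * m.2)
  map_zero' := by simp
  map_add' m n := by
    simp only [Prod.fst_add, Prod.snd_add, Prod.mk_add_mk, Int.cast_add]
    ext <;> ring

lemma latticeHom_apply (A : Matrix (Fin 2) (Fin 2) ℝ) (m : ℤ × ℤ) :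
    latticeHom A m = (A 0 0 * m.1 + A 0 1 * m.2, A 1 0 * m.1 + A 1 1 * m.2) := rfl

variable {A : Matrix (Fin 2) (Fin 2) ℝ}

lemma det_mul_fst (A : Matrix (Fin 2) (Fin 2) ℝ) (m : ℤ × ℤ) :
    A.det * m.1 = A 1 1 * (latticeHom A m).1 - A 0 1 * (latticeHom A m).2 := by
  rw [Matrix.det_fin_two, latticeHom_apply]; ring

lemma det_mul_snd (A : Matrix (Fin 2) (Fin 2) ℝ) (m : ℤ × ℤ) :
    A.det * m.2 = A 0 0 * (latticeHom A m).2 - A 1 0 * (latticeHom A m).1 := by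
  rw [Matrix.det_fin_two, latticeHom_apply]; ring

lemma injective_latticeHom (hA : A.det ≠ 0) : Function.Injective (latticeHom A) := by
  intro m n h
  have h1 := det_mul_fst A m
  have h2 := det_mul_snd A m
  rw [h, ← det_mul_fst] at h1
  rw [h, ← det_mul_snd] at h2
  exact Prod.ext (by exact_mod_cast mul_left_cancel₀ hA h1)
    (by exact_mod_cast mul_left_cancel₀ hA h2)

lemma summable_int_exp_neg_mul_sq {c : ℝ} (hc : 0 < c) :
    Summable fun k : ℤ => Real.exp (-c * (k : ℝ) ^ 2) := by
  have h : Summable fun n : ℕ => Real.exp (-c * (n : ℝ) ^ 2) :=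
    Real.summable_exp_nat_mul_of_ge (neg_lt_zero.mpr hc) fun i => by
      exact_mod_cast Nat.le_self_pow two_ne_zero i
  exact Summable.of_nat_of_neg (by simpa using h) (by simpa using h)

lemma gaussSummable_latticeHom (hA : A.det ≠ 0) : GaussSummable (latticeHom A) := by
  set S := A 0 0 ^ 2 + A 0 1 ^ 2 + A 1 0 ^ 2 + A 1 1 ^ 2 with hS
  have hSpos : 0 < S := by
    have hS0 : 0 ≤ S := by positivity
    refine lt_of_le_of_ne hS0 fun h => hA ?_
    rw [Matrix.det_fin_two]
    have h00 : A 0 0 = 0 := by nlinarith [sq_nonneg (A 0 1), sq_nonneg (A 1 0), sq_nonneg (A 1 1)]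
    have h01 : A 0 1 = 0 := by nlinarith [sq_nonneg (A 0 0), sq_nonneg (A 1 0), sq_nonneg (A 1 1)]
    simp [h00, h01]
  have hlow (m : ℤ × ℤ) : A.det ^ 2 / S * ((m.1 : ℝ) ^ 2 + (m.2 : ℝ) ^ 2) ≤
      (latticeHom A m).1 ^ 2 + (latticeHom A m).2 ^ 2 := by
    rw [div_mul_eq_mul_div, div_le_iff₀ hSpos, mul_add, ← mul_pow, ← mul_pow, det_mul_fst,
      det_mul_snd]
    set x := (latticeHom A m).1
    set y := (latticeHom A m).2
    nlinarith [sq_nonneg (A 1 1 * y + A 0 1 * x), sq_nonneg (A 0 0 * x + A 1 0 * y)]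
  set c := Real.pi / 4 * (A.det ^ 2 / S) with hc
  have hcpos : 0 < c := by positivity
  have h1 := (summable_int_exp_neg_mul_sq hcpos).mul_of_nonneg (summable_int_exp_neg_mul_sq hcpos)
    (fun _ => (Real.exp_pos _).le) (fun _ => (Real.exp_pos _).le)
  refine h1.of_nonneg_of_le (fun _ => (Real.exp_pos _).le) fun m => ?_
  rw [← Real.exp_add, Real.exp_le_exp]
  have := mul_le_mul_of_nonneg_left (hlow m) (by positivity : 0 ≤ Real.pi / 4)
  rw [← mul_assoc, ← hc] at this
  linarith

lemma exists_norm_sub_latticeHom_le (hA : A.det ≠ 0) :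
    ∃ R : ℝ, ∀ z, ∃ m, ‖z - latticeHom A m‖ ≤ R := by
  refine ⟨|A 0 0| + |A 0 1| + |A 1 0| + |A 1 1|, fun z => ?_⟩
  set α := (A 1 1 * z.1 - A 0 1 * z.2) / A.det with hα
  set β := (A 0 0 * z.2 - A 1 0 * z.1) / A.det with hβ
  have hbound (a b : ℝ) : |a * Int.fract α + b * Int.fract β| ≤ |a| + |b| := by
    refine (abs_add_le _ _).trans (add_le_add ?_ ?_) <;>
    · rw [abs_mul, Int.abs_fract]
      exact mul_le_of_le_one_right (abs_nonneg _) (Int.fract_lt_one _).le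
  have e1 : z.1 = A 0 0 * α + A 0 1 * β := by
    rw [hα, hβ]
    field_simp
    rw [Matrix.det_fin_two]
    ring
  have e2 : z.2 = A 1 0 * α + A 1 1 * β := by
    rw [hα, hβ]
    field_simp
    rw [Matrix.det_fin_two]
    ring
  refine ⟨(⌊α⌋, ⌊β⌋), ?_⟩
  have h1 : (z - latticeHom A (⌊α⌋, ⌊β⌋)).1 = A 0 0 * Int.fract α + A 0 1 * Int.fract β := by
    rw [Prod.fst_sub, e1, latticeHom_apply, Int.fract, Int.fract]; ring
  have h2 : (z - latticeHom A (⌊α⌋, ⌊β⌋)).2 = A 1 0 * Int.fract α + A 1 1 * Int.fract β := by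
    rw [Prod.snd_sub, e2, latticeHom_apply, Int.fract, Int.fract]; ring
  rw [Prod.norm_def, h1, h2, Real.norm_eq_abs, Real.norm_eq_abs]
  refine max_le ((hbound _ _).trans ?_) ((hbound _ _).trans ?_)
  · linarith [abs_nonneg (A 1 0), abs_nonneg (A 1 1)]
  · linarith [abs_nonneg (A 0 0), abs_nonneg (A 0 1)]

lemma exists_addMonoidHom_ne_zero {m : ℤ × ℤ} (hm : m ≠ 0) : ∃ ℓ : ℤ × ℤ →+ ℝ, ℓ m ≠ 0 := by
  by_cases h : m.1 = 0
  · refine ⟨(Int.castAddHom ℝ).comp (AddMonoidHom.snd ℤ ℤ), ?_⟩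
    have : m.2 ≠ 0 := fun h2 => hm (Prod.ext h h2)
    simpa using this
  · exact ⟨(Int.castAddHom ℝ).comp (AddMonoidHom.fst ℤ ℤ), by simpa using h⟩

end Lattice

/-- for a Gabor Riesz sequence with `S₀`-generator,
`𝔍(𝒢) ⊆ (1/m)Λ` for some `m ≥ 1`. -/
theorem statement_7 (g : L2) (hg : InS0 g) (Λ : Set (ℝ × ℝ)) (hΛ : IsLattice Λ)
    (hriesz : IsRieszSeq g Λ) :
    ∃ m : ℕ, 1 ≤ m ∧
      stab (gaborSpan g Λ) ⊆ {p : ℝ × ℝ | ∃ q ∈ Λ, p = ((m : ℝ))⁻¹ • q} := by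
  obtain ⟨A, hA, rfl⟩ := hΛ
  have hdet : A.det ≠ 0 := hA.ne_zero
  have hrange : {p : ℝ × ℝ | ∃ k l : ℤ, p = (A 0 0 * k + A 0 1 * l, A 1 0 * k + A 1 1 * l)}
      = Set.range (latticeHom A) := by
    ext q
    constructor
    · rintro ⟨k, l, rfl⟩
      exact ⟨(k, l), rfl⟩
    · rintro ⟨m, rfl⟩
      exact ⟨m.1, m.2, rfl⟩
  rw [hrange] at hriesz ⊢
  obtain ⟨R, hR⟩ := exists_norm_sub_latticeHom_le hdet
  obtain ⟨m, hm, h⟩ := exists_nsmul_mem_lattice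
    (default : HilbertBasis (ℤ × ℤ) ℂ (lp (fun _ : ℤ × ℤ => ℂ) 2))
    (gaussSummable_latticeHom hdet) (injective_latticeHom hdet)
    (fun _ => exists_addMonoidHom_ne_zero) hR hg hriesz
  refine ⟨m, hm, fun z hz => ?_⟩
  obtain ⟨s, hs⟩ := h z hz
  refine ⟨_, ⟨s, rfl⟩, ?_⟩
  have hm0 : (m : ℝ) ≠ 0 := by exact_mod_cast (Nat.one_le_iff_ne_zero.mp hm)
  rw [← hs, ← Nat.cast_smul_eq_nsmul ℝ, inv_smul_smul₀ hm0]

end
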